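/- arXiv:1102.3224 — 2 statements merged into one kernel-verified Lean document; each statement's English description precedes it below -/
import Mathlib

section
/- Let D ⊆ S² be an open region, S ⊆ D a carpet, and Γ a family of paths each contained in D. If f : D → D̃ is a quasiconformal homeomorphism onto an open region D̃ ⊆ S², S̃ := f(S), and Γ̃ := {f∘γ : γ ∈ Γ}, then mod_{S̃}(Γ̃) = mod_S(Γ). -/
open Set Metric

noncomputable section

/-- Level-`n` approximation `Q_n` of the standard `1/p`-Sierpiński carpet in `ℂ ≅ ℝ²`:
`Q_0` is the closed unit square, and `Q_{n+1}` is the union of the images of `Q_n` under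
the `p² - 1` contractions `z ↦ (z + i + j·√-1)/p` with `(i,j)` ranging over all non-middle
positions; this is the usual subdivide-and-remove-middle-squares construction. -/
def carpetApprox (p : ℕ) : ℕ → Set ℂ
  | 0 => {z : ℂ | z.re ∈ Set.Icc (0:ℝ) 1 ∧ z.im ∈ Set.Icc (0:ℝ) 1}
  | n + 1 =>
      ⋃ (i : ℕ) (j : ℕ) (_ : i < p) (_ : j < p)
        (_ : ¬(i = (p - 1) / 2 ∧ j = (p - 1) / 2)),
        (fun z : ℂ => (z + (i : ℂ) + (j : ℂ) * Complex.I) / (p : ℂ)) '' carpetApprox p n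

/-- The standard `1/p`-Sierpiński carpet `S_p ⊆ ℝ² ≅ ℂ`. -/
def sierpinskiCarpet (p : ℕ) : Set ℂ := ⋂ n, carpetApprox p n

/-- `η : [0,∞) → [0,∞)` is a (self-)homeomorphism of `[0,∞)`: it is continuous, strictly
increasing on `[0,∞)`, fixes `0` and maps `[0,∞)` onto `[0,∞)`. -/
def IsQSControl (η : ℝ → ℝ) : Prop :=
  ContinuousOn η (Set.Ici 0) ∧ StrictMonoOn η (Set.Ici 0) ∧ η 0 = 0 ∧
    Set.SurjOn η (Set.Ici 0) (Set.Ici 0)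

/-- A map `f` between metric spaces is quasisymmetric: for some homeomorphism
`η : [0,∞) → [0,∞)` one has `d(f u, f v) ≤ η(d(u,v)/d(u,w)) · d(f u, f w)` for all `u,v,w`
with `u ≠ w`. -/
def IsQSMap {X Y : Type*} [MetricSpace X] [MetricSpace Y] (f : X → Y) : Prop :=
  ∃ η : ℝ → ℝ, IsQSControl η ∧
    ∀ u v w : X, u ≠ w → dist (f u) (f v) ≤ η (dist u v / dist u w) * dist (f u) (f w)

/-- The boundary of the axis-parallel closed square with lower-left corner `c` and
side length `l`. -/
def squareBoundary (c : ℂ) (l : ℝ) : Set ℂ :=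
  {z : ℂ | max |z.re - (c.re + l / 2)| |z.im - (c.im + l / 2)| = l / 2}

/-- The outer square `O = ∂([0,1]×[0,1])`. -/
def outerSquare : Set ℂ := squareBoundary 0 1

/-- The middle square `M = ∂([(p-1)/(2p),(p+1)/(2p)]²)`. -/
def middleSquare (p : ℕ) : Set ℂ :=
  squareBoundary ((((p : ℝ) - 1) / (2 * p) : ℝ) * (1 + Complex.I)) (1 / p)

end

open MeasureTheory Filter Topology
open scoped ENNReal

noncomputable section

/-- The unit sphere `S² = {x ∈ ℝ³ : |x| = 1}`, with the metric induced from `ℝ³`. -/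
def Sphere2 : Set (EuclideanSpace ℝ (Fin 3)) := Metric.sphere 0 1

/-- The `2`-dimensional Hausdorff measure `σ` on `S²`. -/
def sphereMeasure : Measure ↥Sphere2 := μH[2]

/-- A path in `S²`: a continuous map of a finite interval (of one of the four kinds
`[a,b]`, `[a,b)`, `(a,b]`, `(a,b)` with `a < b`) into `S²`. -/
structure SpherePath where
  /-- The parameter interval. -/
  I : Set ℝ
  /-- The parameter set is a finite interval. -/
  hI : ∃ a b : ℝ, a < b ∧
    (I = Set.Icc a b ∨ I = Set.Ico a b ∨ I = Set.Ioc a b ∨ I = Set.Ioo a b)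
  /-- The parametrizing map. -/
  toFun : ℝ → ↥Sphere2
  /-- Continuity on the parameter interval. -/
  cont : ContinuousOn toFun I

/-- The image of a path. -/
def SpherePath.image (γ : SpherePath) : Set ↥Sphere2 := γ.toFun '' γ.I

/-- A path is locally rectifiable if it has finite length (total variation) on every
compact subinterval of its parameter interval. -/
def SpherePath.LocRectifiable (γ : SpherePath) : Prop :=
  ∀ a b : ℝ, Set.Icc a b ⊆ γ.I → eVariationOn γ.toFun (Set.Icc a b) < ⊤

/-- The arclength integral `∫ ρ ds` of a density `ρ` over the restriction of the curve
`f` to `[a,b]`, computed via the arclength parametrization: if `s(t)` denotes the length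
of `f|[a,t]` and `L` the length of `f|[a,b]`, this is `∫₀ᴸ ρ(f(t(u))) du` where
`t(u) = inf{t ∈ [a,b] : s(t) ≥ u}`. -/
def arcIntegralOn (ρ : ↥Sphere2 → ℝ≥0∞) (f : ℝ → ↥Sphere2) (a b : ℝ) : ℝ≥0∞ :=
  ∫⁻ u in Set.Ico (0 : ℝ) (eVariationOn f (Set.Icc a b)).toReal,
    ρ (f (sInf {t | t ∈ Set.Icc a b ∧
      ENNReal.ofReal u ≤ eVariationOn f (Set.Icc a t)}))

/-- The arclength integral `∫_γ ρ ds` of a density `ρ` along a path `γ`, defined as the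
supremum of the arclength integrals over all compact subintervals of the parameter
interval. -/
def SpherePath.lineIntegral (γ : SpherePath) (ρ : ↥Sphere2 → ℝ≥0∞) : ℝ≥0∞ :=
  ⨆ (a : ℝ) (b : ℝ) (_ : Set.Icc a b ⊆ γ.I), arcIntegralOn ρ γ.toFun a b

/-- The conformal modulus `mod(Γ)` of a family of paths in `S²`: the infimum of
`∫ ρ² dσ` over all Borel densities `ρ : S² → [0,∞]` with `∫_γ ρ ds ≥ 1` for every
locally rectifiable `γ ∈ Γ`. -/
def conformalModulus (Γ : Set SpherePath) : ℝ≥0∞ :=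
  ⨅ (ρ : ↥Sphere2 → ℝ≥0∞) (_ : Measurable ρ)
    (_ : ∀ γ ∈ Γ, γ.LocRectifiable → 1 ≤ γ.lineIntegral ρ),
    ∫⁻ x, ρ x ^ 2 ∂sphereMeasure

/-- A carpet in `S²`: a subset homeomorphic to the standard Sierpiński carpet `S_3`. -/
def IsCarpet (S : Set ↥Sphere2) : Prop := Nonempty (↥S ≃ₜ ↥(sierpinskiCarpet 3))

/-- A peripheral circle of a carpet `S ⊆ S²`: a Jordan curve `C ⊆ S` (a subset
homeomorphic to a circle) whose complement `S ∖ C` in `S` is connected. -/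
def IsPeripheralCircle (S C : Set ↥Sphere2) : Prop :=
  C ⊆ S ∧ Nonempty (↥C ≃ₜ ↥(Metric.sphere (0 : ℂ) 1)) ∧ IsConnected (S \ C)

/-- `Σ_{C : γ ∩ C ≠ ∅} ρ(C)`: the total mass of the peripheral circles of `S` met by the
path `γ`. -/
def pathMassSum (S : Set ↥Sphere2) (ρ : Set ↥Sphere2 → ℝ≥0∞) (γ : SpherePath) : ℝ≥0∞ :=
  ∑' C : {C : Set ↥Sphere2 // IsPeripheralCircle S C ∧ (γ.image ∩ C).Nonempty}, ρ C

/-- A mass distribution `ρ` on the peripheral circles of `S` is admissible for the carpet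
modulus `mod_S(Γ)` if there is an exceptional family `Γ₀ ⊆ Γ` of conformal modulus zero
such that every `γ ∈ Γ ∖ Γ₀` meets peripheral circles of total mass at least `1`. -/
def CarpetAdmissible (S : Set ↥Sphere2) (Γ : Set SpherePath)
    (ρ : Set ↥Sphere2 → ℝ≥0∞) : Prop :=
  ∃ Γ₀ : Set SpherePath, Γ₀ ⊆ Γ ∧ conformalModulus Γ₀ = 0 ∧
    ∀ γ ∈ Γ \ Γ₀, 1 ≤ pathMassSum S ρ γ

/-- The total mass `Σ_i ρ(C_i)²` of a mass distribution on the peripheral circles of a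
carpet `S`. -/
def carpetMass (S : Set ↥Sphere2) (ρ : Set ↥Sphere2 → ℝ≥0∞) : ℝ≥0∞ :=
  ∑' C : {C : Set ↥Sphere2 // IsPeripheralCircle S C}, ρ C ^ 2

/-- The carpet modulus `mod_S(Γ)` of a path family `Γ` with respect to a carpet
`S ⊆ S²`. -/
def carpetModulus (S : Set ↥Sphere2) (Γ : Set SpherePath) : ℝ≥0∞ :=
  ⨅ (ρ : Set ↥Sphere2 → ℝ≥0∞) (_ : CarpetAdmissible S Γ ρ), carpetMass S ρ

/-- A family of Jordan curves in `S²` consists of uniform quasicircles if there is a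
single control function `η` such that each curve in the family is the image of the
Euclidean unit circle under an `η`-quasisymmetric map. -/
def UniformQuasicircles (𝒞 : Set (Set ↥Sphere2)) : Prop :=
  ∃ η : ℝ → ℝ, IsQSControl η ∧ ∀ C ∈ 𝒞,
    ∃ f : ↥(Metric.sphere (0 : ℂ) 1) → ↥Sphere2, Set.range f = C ∧
      Function.Injective f ∧
      ∀ u v w : ↥(Metric.sphere (0 : ℂ) 1), u ≠ w →
        dist (f u) (f v) ≤ η (dist u v / dist u w) * dist (f u) (f w)

end

noncomputable section

/-- The distortion ratio `H_f(x,r)` of the metric definition of quasiconformality for a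
map `f` defined on `D ⊆ S²`:
`sup{d(f x, f y) : y ∈ D, d(x,y) ≤ r} / inf{d(f x, f y) : y ∈ D, d(x,y) ≥ r}`. -/
def qcRatioOn (f : ↥Sphere2 → ↥Sphere2) (D : Set ↥Sphere2) (x : ↥Sphere2) (r : ℝ) :
    ℝ≥0∞ :=
  (⨆ y ∈ {y | y ∈ D ∧ dist x y ≤ r}, ENNReal.ofReal (dist (f x) (f y))) /
    ⨅ y ∈ {y | y ∈ D ∧ r ≤ dist x y}, ENNReal.ofReal (dist (f x) (f y))

/-- `f` is a quasiconformal homeomorphism of the open region `D ⊆ S²` onto the open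
region `D'` (metric definition): `f` restricts to a homeomorphism of `D` onto `D'` and
there is `H < ∞` with `limsup_{r→0} H_f(x,r) ≤ H` for every `x ∈ D`. -/
def IsQuasiconformalOn (f : ↥Sphere2 → ↥Sphere2) (D D' : Set ↥Sphere2) : Prop :=
  IsOpen D ∧ IsOpen D' ∧ Set.BijOn f D D' ∧ ContinuousOn f D ∧
    (∃ g : ↥Sphere2 → ↥Sphere2, ContinuousOn g D' ∧ ∀ x ∈ D, g (f x) = x) ∧
    ∃ H : ℝ≥0∞, H < ⊤ ∧ ∀ x ∈ D,
      Filter.limsup (qcRatioOn f D x) (nhdsWithin 0 (Set.Ioi (0 : ℝ))) ≤ H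

end

open scoped NNReal

section ArcMeasure

/-- A finite measure on `ℝ` that is dominated by another one on intervals is dominated by it. -/
theorem measure_le_of_Ioo_le_Icc (μ ν : Measure ℝ) [IsFiniteMeasure μ] [IsFiniteMeasure ν]
    (h : ∀ c d, c < d → μ (Ioo c d) ≤ ν (Icc c d)) : μ ≤ ν := by
  have hball : ∀ x r : ℝ, 0 ≤ r → μ (closedBall x r) ≤ ν (closedBall x r) := by
    intro x r hr
    have hlim : Tendsto (fun ε : ℝ => ν (cthickening ε (closedBall x r))) (𝓝[>] 0)
        (𝓝 (ν (closedBall x r))) := by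
      exact (tendsto_measure_cthickening_of_isClosed
        ⟨1, one_pos, measure_ne_top _ _⟩ isClosed_closedBall).mono_left nhdsWithin_le_nhds
    refine ge_of_tendsto hlim ?_
    filter_upwards [self_mem_nhdsWithin] with ε hε
    have hε : 0 < ε := hε
    rw [cthickening_closedBall hε.le hr, Real.closedBall_eq_Icc, Real.closedBall_eq_Icc]
    refine (measure_mono ?_).trans (h (x - (ε + r)) (x + (ε + r)) (by linarith))
    intro y hy
    exact ⟨by linarith [hy.1], by linarith [hy.2]⟩
  have hopen : ∀ U : Set ℝ, IsOpen U → μ U ≤ ν U := by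
    intro U hU
    obtain ⟨t, r, htc, htU, htr, hcov, hdisj⟩ :=
      Besicovitch.exists_disjoint_closedBall_covering_ae μ
        (fun x => {r | closedBall x r ⊆ U}) U (by
          intro x hx δ hδ
          obtain ⟨ε, hε, hεU⟩ := nhds_basis_closedBall.mem_iff.1 (hU.mem_nhds hx)
          exact ⟨min ε (δ / 2), (closedBall_subset_closedBall (min_le_left _ _)).trans hεU,
            lt_min hε (half_pos hδ), (min_le_right _ _).trans_lt (half_lt_self hδ)⟩)
        (fun _ => 1) (fun _ _ => one_pos)
    calc μ U ≤ μ ((U \ ⋃ x ∈ t, closedBall x (r x)) ∪ ⋃ x ∈ t, closedBall x (r x)) :=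
          measure_mono (by rw [sdiff_union_self]; exact subset_union_left)
      _ ≤ μ (U \ ⋃ x ∈ t, closedBall x (r x)) + μ (⋃ x ∈ t, closedBall x (r x)) :=
          measure_union_le _ _
      _ = μ (⋃ x ∈ t, closedBall x (r x)) := by rw [hcov, zero_add]
      _ ≤ ∑' x : t, μ (closedBall (x : ℝ) (r x)) := measure_biUnion_le _ htc _
      _ ≤ ∑' x : t, ν (closedBall (x : ℝ) (r x)) :=
          ENNReal.tsum_le_tsum fun x => hball _ _ (htr x x.2).2.1.le
      _ = ν (⋃ x ∈ t, closedBall x (r x)) :=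
          (measure_biUnion htc hdisj fun x _ => isClosed_closedBall.measurableSet).symm
      _ ≤ ν U := measure_mono (iUnion₂_subset fun x hx => (htr x hx).1)
  refine Measure.le_iff.2 fun s _ => ?_
  rw [s.measure_eq_iInf_isOpen ν]
  exact le_iInf₂ fun U hsU => le_iInf fun hU => (measure_mono hsU).trans (hopen U hU)

variable {E : Type*} [PseudoEMetricSpace E]

/-- The first time at which the length of the curve `p`, measured from `a`, reaches `u`. -/
noncomputable def arcTime (p : ℝ → E) (a b u : ℝ) : ℝ :=
  sInf {t | t ∈ Icc a b ∧ ENNReal.ofReal u ≤ eVariationOn p (Icc a t)}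

/-- The arclength measure of the curve `p` restricted to `[a, b]`, carried to the parameter line. -/
noncomputable def arcMeasure (p : ℝ → E) (a b : ℝ) : Measure ℝ :=
  (volume.restrict (Ico (0 : ℝ) (eVariationOn p (Icc a b)).toReal)).map (arcTime p a b)

/-- The curve `p` restricted to `[a, b]` and extended to `ℝ` by constants. -/
noncomputable def clampCurve (p : ℝ → E) {a b : ℝ} (hab : a ≤ b) (t : ℝ) : E :=
  p (projIcc a b hab t)

variable {p : ℝ → E} {a b : ℝ}

theorem right_mem_arcTime_set (hab : a ≤ b) (hv : eVariationOn p (Icc a b) ≠ ⊤) {u : ℝ}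
    (hu : u ∈ Ico (0 : ℝ) (eVariationOn p (Icc a b)).toReal) :
    b ∈ {t | t ∈ Icc a b ∧ ENNReal.ofReal u ≤ eVariationOn p (Icc a t)} :=
  ⟨right_mem_Icc.2 hab, by
    rw [← ENNReal.ofReal_toReal hv]; exact ENNReal.ofReal_le_ofReal hu.2.le⟩

theorem bddBelow_arcTime_set (u : ℝ) :
    BddBelow {t | t ∈ Icc a b ∧ ENNReal.ofReal u ≤ eVariationOn p (Icc a t)} :=
  ⟨a, fun _ ht => ht.1.1⟩

theorem arcTime_mem (hab : a ≤ b) (hv : eVariationOn p (Icc a b) ≠ ⊤) {u : ℝ}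
    (hu : u ∈ Ico (0 : ℝ) (eVariationOn p (Icc a b)).toReal) : arcTime p a b u ∈ Icc a b :=
  ⟨le_csInf ⟨b, right_mem_arcTime_set hab hv hu⟩ fun _ ht => ht.1.1,
    csInf_le (bddBelow_arcTime_set u) (right_mem_arcTime_set hab hv hu)⟩

theorem aemeasurable_arcTime (hab : a ≤ b) (hv : eVariationOn p (Icc a b) ≠ ⊤) :
    AEMeasurable (arcTime p a b)
      (volume.restrict (Ico (0 : ℝ) (eVariationOn p (Icc a b)).toReal)) := by
  refine aemeasurable_restrict_of_monotoneOn measurableSet_Ico fun u _ v hv' huv => ?_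
  exact csInf_le_csInf (bddBelow_arcTime_set u) ⟨b, right_mem_arcTime_set hab hv hv'⟩
    fun t ht => ⟨ht.1, (ENNReal.ofReal_le_ofReal huv).trans ht.2⟩

instance isFiniteMeasure_arcMeasure : IsFiniteMeasure (arcMeasure p a b) := by
  unfold arcMeasure; infer_instance

theorem eVariationOn_Icc_ne_top (hv : eVariationOn p (Icc a b) ≠ ⊤) {t : ℝ} (ht : t ∈ Icc a b) :
    eVariationOn p (Icc a t) ≠ ⊤ :=
  ne_top_of_le_ne_top hv (eVariationOn.mono _ (Icc_subset_Icc_right ht.2))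

theorem ofReal_variation_sub (hv : eVariationOn p (Icc a b) ≠ ⊤) {c d : ℝ} (hac : a ≤ c)
    (hcd : c ≤ d) (hdb : d ≤ b) :
    ENNReal.ofReal ((eVariationOn p (Icc a d)).toReal - (eVariationOn p (Icc a c)).toReal) =
      eVariationOn p (Icc c d) := by
  have h := eVariationOn.Icc_add_Icc p (s := univ) hac hcd (mem_univ _)
  simp only [univ_inter] at h
  have h1 := eVariationOn_Icc_ne_top hv ⟨hac, hcd.trans hdb⟩
  rw [ENNReal.ofReal_sub _ ENNReal.toReal_nonneg, ENNReal.ofReal_toReal h1,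
    ENNReal.ofReal_toReal (eVariationOn_Icc_ne_top hv ⟨hac.trans hcd, hdb⟩), ← h]
  exact ENNReal.add_sub_cancel_left h1

theorem edist_le_arcMeasure (hab : a ≤ b) (hv : eVariationOn p (Icc a b) ≠ ⊤) {c d : ℝ}
    (hcd : c ≤ d) :
    edist (clampCurve p hab c) (clampCurve p hab d) ≤ arcMeasure p a b (Icc c d) := by
  set c' : ℝ := (projIcc a b hab c : ℝ) with hc'
  set d' : ℝ := (projIcc a b hab d : ℝ) with hd'
  have hc'd' : c' ≤ d' := monotone_projIcc hab hcd
  have hc'm : c' ∈ Icc a b := (projIcc a b hab c).2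
  have hd'm : d' ∈ Icc a b := (projIcc a b hab d).2
  rcases hc'd'.eq_or_lt with heq | hlt
  · have : clampCurve p hab c = clampCurve p hab d := by
      simp only [clampCurve, ← hc', ← hd', heq]
    rw [this, edist_self]; exact zero_le
  have hcc' : c ≤ c' := by
    by_contra! hlt'
    have : d' ≤ c' := by
      simp only [hc', hd', coe_projIcc] at hlt' ⊢
      grind
    linarith
  have hdd' : d' ≤ d := by
    by_contra! hlt'
    have : d' ≤ c' := by
      simp only [hc', hd', coe_projIcc] at hlt' ⊢
      grind
    linarith
  have h1 : edist (clampCurve p hab c) (clampCurve p hab d) ≤ eVariationOn p (Icc c' d') :=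
    eVariationOn.edist_le p (left_mem_Icc.2 hc'd') (right_mem_Icc.2 hc'd')
  refine h1.trans ?_
  rw [← ofReal_variation_sub hv hc'm.1 hc'd' hd'm.2, ← Real.volume_Ioo, arcMeasure,
    Measure.map_apply_of_aemeasurable (aemeasurable_arcTime hab hv) measurableSet_Icc]
  rw [Measure.restrict_apply' measurableSet_Ico]
  refine measure_mono fun u hu => ⟨⟨?_, ?_⟩, ?_⟩
  · have hmem : d' ∈ {t | t ∈ Icc a b ∧ ENNReal.ofReal u ≤ eVariationOn p (Icc a t)} :=
      ⟨hd'm, ENNReal.ofReal_le_of_le_toReal hu.2.le⟩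
    refine hcc'.trans (le_csInf ⟨d', hmem⟩ fun t ht => ?_)
    by_contra! htc
    have : u ≤ (eVariationOn p (Icc a c')).toReal :=
      (ENNReal.ofReal_le_iff_le_toReal (eVariationOn_Icc_ne_top hv hc'm)).1
        (ht.2.trans (eVariationOn.mono _ (Icc_subset_Icc_right htc.le)))
    exact absurd hu.1 (not_lt.2 this)
  · exact (csInf_le (bddBelow_arcTime_set u)
      ⟨hd'm, ENNReal.ofReal_le_of_le_toReal hu.2.le⟩).trans hdd'
  · exact ⟨ENNReal.toReal_nonneg.trans hu.1.le, hu.2.trans_le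
      (ENNReal.toReal_mono hv (eVariationOn.mono _ (Icc_subset_Icc_right hd'm.2)))⟩

theorem arcMeasure_Ioo_le (hab : a ≤ b) (hv : eVariationOn p (Icc a b) ≠ ⊤) (c d : ℝ) :
    arcMeasure p a b (Ioo c d) ≤ eVariationOn (clampCurve p hab) (Icc c d) := by
  rw [arcMeasure, Measure.map_apply_of_aemeasurable (aemeasurable_arcTime hab hv)
    measurableSet_Ioo, Measure.restrict_apply' measurableSet_Ico]
  rcases (arcTime p a b ⁻¹' Ioo c d ∩
    Ico (0 : ℝ) (eVariationOn p (Icc a b)).toReal).eq_empty_or_nonempty with he | ⟨v, hv1, hv2⟩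
  · rw [he, measure_empty]; exact zero_le
  have hvm := arcTime_mem hab hv hv2
  set c' := max a c
  set d' := min b d
  have hc'd' : c' ≤ d' :=
    max_le (le_min hab (hvm.1.trans hv1.2.le)) (le_min (hv1.1.le.trans hvm.2)
      (hv1.1.trans hv1.2).le)
  have hac' : a ≤ c' := le_max_left _ _
  have hd'b : d' ≤ b := min_le_left _ _
  calc volume (arcTime p a b ⁻¹' Ioo c d ∩ Ico (0 : ℝ) (eVariationOn p (Icc a b)).toReal)
      ≤ volume (Icc (eVariationOn p (Icc a c')).toReal (eVariationOn p (Icc a d')).toReal) := by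
        refine measure_mono fun u ⟨hu1, hu2⟩ => ⟨?_, ?_⟩
        · by_contra! hlt
          have hmem : arcTime p a b u ≤ c' := csInf_le (bddBelow_arcTime_set u)
            ⟨⟨hac', hc'd'.trans hd'b⟩, ENNReal.ofReal_le_of_le_toReal hlt.le⟩
          rcases le_total a c with hle | hle
          · rw [show c' = c from max_eq_right hle] at hmem
            exact absurd hu1.1 (not_lt.2 hmem)
          · rw [show c' = a from max_eq_left hle, Icc_self,
              eVariationOn.subsingleton _ subsingleton_singleton, ENNReal.toReal_zero] at hlt
            exact absurd hu2.1 (not_le.2 hlt)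
        · obtain ⟨τ, hτ, hτd⟩ := exists_lt_of_csInf_lt ⟨b, right_mem_arcTime_set hab hv hu2⟩ hu1.2
          exact (ENNReal.ofReal_le_iff_le_toReal
            (eVariationOn_Icc_ne_top hv ⟨hac'.trans hc'd', hd'b⟩)).1
            (hτ.2.trans (eVariationOn.mono _ (Icc_subset_Icc_right (le_min hτ.1.2 hτd.le))))
    _ = eVariationOn p (Icc c' d') := by
        rw [Real.volume_Icc, ofReal_variation_sub hv hac' hc'd' hd'b]
    _ = eVariationOn (clampCurve p hab) (Icc c' d') := by
        refine eVariationOn.congr fun t ht => ?_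
        rw [clampCurve, projIcc_of_mem hab ⟨hac'.trans ht.1, ht.2.trans hd'b⟩]
    _ ≤ eVariationOn (clampCurve p hab) (Icc c d) :=
        eVariationOn.mono _ (Icc_subset_Icc (le_max_right _ _) (min_le_right _ _))

theorem continuous_clampCurve (hab : a ≤ b) (hp : ContinuousOn p (Icc a b)) :
    Continuous (clampCurve p hab) :=
  hp.comp_continuous (continuous_subtype_val.comp continuous_projIcc) fun t =>
    (projIcc a b hab t).2

end ArcMeasure

theorem arcIntegralOn_eq_lintegral {f : ℝ → ↥Sphere2} {a b : ℝ} (hab : a ≤ b)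
    (hv : eVariationOn f (Icc a b) ≠ ⊤) (hf : ContinuousOn f (Icc a b))
    {ρ : ↥Sphere2 → ℝ≥0∞} (hρ : Measurable ρ) :
    arcIntegralOn ρ f a b = ∫⁻ t, ρ (clampCurve f hab t) ∂arcMeasure f a b := by
  have hm : Measurable fun t => ρ (clampCurve f hab t) :=
    hρ.comp (continuous_clampCurve hab hf).measurable
  rw [arcMeasure, lintegral_map' hm.aemeasurable (aemeasurable_arcTime hab hv)]
  refine setLIntegral_congr_fun measurableSet_Ico fun u hu => ?_
  change ρ (f (arcTime f a b u)) = _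
  rw [clampCurve, projIcc_of_mem hab (arcTime_mem hab hv hu)]

section SphereRegularity

/-- The upper hemisphere over the plane `pᗮ`, parametrized as a graph over `EuclideanSpace ℝ (Fin 2)`
through an isometric identification `e` of the latter with `pᗮ`. -/
noncomputable def sphereGraph (p : EuclideanSpace ℝ (Fin 3))
    (e : EuclideanSpace ℝ (Fin 2) ≃ₗᵢ[ℝ] (Submodule.span ℝ {p})ᗮ) (u : EuclideanSpace ℝ (Fin 2)) :
    EuclideanSpace ℝ (Fin 3) :=
  (e u : EuclideanSpace ℝ (Fin 3)) + √(1 - ‖u‖ ^ 2) • p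

variable {p : EuclideanSpace ℝ (Fin 3)}

theorem exists_linearIsometryEquiv_orthogonal (hp : ‖p‖ = 1) :
    Nonempty (EuclideanSpace ℝ (Fin 2) ≃ₗᵢ[ℝ] (Submodule.span ℝ {p})ᗮ) := by
  have hp0 : p ≠ 0 := by rintro rfl; simp at hp
  have h : Module.finrank ℝ (Submodule.span ℝ {p})ᗮ = 2 := by
    have : Fact (Module.finrank ℝ (EuclideanSpace ℝ (Fin 3)) = 2 + 1) := ⟨by simp⟩
    exact Submodule.finrank_orthogonal_span_singleton hp0
  exact ⟨((stdOrthonormalBasis ℝ (Submodule.span ℝ {p})ᗮ).reindex (finCongr h)).repr.symm⟩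

variable (e : EuclideanSpace ℝ (Fin 2) ≃ₗᵢ[ℝ] (Submodule.span ℝ {p})ᗮ)

theorem norm_add_smul_sq (hp : ‖p‖ = 1) (u : EuclideanSpace ℝ (Fin 2)) (s : ℝ) :
    ‖(e u : EuclideanSpace ℝ (Fin 3)) + s • p‖ ^ 2 = ‖u‖ ^ 2 + s ^ 2 := by
  have h0 : inner ℝ (e u : EuclideanSpace ℝ (Fin 3)) p = 0 := by
    have := (Submodule.mem_orthogonal_singleton_iff_inner_left (𝕜 := ℝ)).1 (e u).2
    simpa using this
  have h1 : ‖(e u : EuclideanSpace ℝ (Fin 3))‖ = ‖u‖ := by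
    rw [Submodule.norm_coe, e.norm_map]
  rw [norm_add_sq_real, inner_smul_right, h0, h1, norm_smul, hp]
  simp

theorem dist_sphereGraph_le (hp : ‖p‖ = 1) {u v : EuclideanSpace ℝ (Fin 2)}
    (hu : ‖u‖ ≤ 1 / 2) (hv : ‖v‖ ≤ 1 / 2) :
    dist (sphereGraph p e u) (sphereGraph p e v) ≤ 2 * dist u v := by
  have hsub : sphereGraph p e u - sphereGraph p e v =
      (e (u - v) : EuclideanSpace ℝ (Fin 3)) + (√(1 - ‖u‖ ^ 2) - √(1 - ‖v‖ ^ 2)) • p := by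
    simp only [sphereGraph, map_sub, Submodule.coe_sub, sub_smul]; abel
  have hnu := norm_nonneg u
  have hnv := norm_nonneg v
  have hsu : 1 / 2 ≤ √(1 - ‖u‖ ^ 2) := Real.le_sqrt_of_sq_le (by nlinarith)
  have hsv : 1 / 2 ≤ √(1 - ‖v‖ ^ 2) := Real.le_sqrt_of_sq_le (by nlinarith)
  have hsu2 : √(1 - ‖u‖ ^ 2) ^ 2 = 1 - ‖u‖ ^ 2 := Real.sq_sqrt (by nlinarith)
  have hsv2 : √(1 - ‖v‖ ^ 2) ^ 2 = 1 - ‖v‖ ^ 2 := Real.sq_sqrt (by nlinarith)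
  have htri : |‖u‖ - ‖v‖| ≤ ‖u - v‖ := abs_norm_sub_norm_le u v
  have hdiff : |√(1 - ‖u‖ ^ 2) - √(1 - ‖v‖ ^ 2)| ≤ ‖u - v‖ := by
    set x := √(1 - ‖u‖ ^ 2)
    set y := √(1 - ‖v‖ ^ 2)
    calc |x - y| ≤ |x - y| * (x + y) := le_mul_of_one_le_right (abs_nonneg _) (by linarith)
      _ = |(x - y) * (x + y)| := by rw [abs_mul, abs_of_nonneg (by linarith : 0 ≤ x + y)]
      _ = |(‖u‖ - ‖v‖) * (‖u‖ + ‖v‖)| := by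
          rw [← abs_neg]; congr 1; linear_combination hsv2 - hsu2
      _ = |‖u‖ - ‖v‖| * (‖u‖ + ‖v‖) := by rw [abs_mul, abs_of_nonneg (by linarith : 0 ≤ ‖u‖ + ‖v‖)]
      _ ≤ |‖u‖ - ‖v‖| := mul_le_of_le_one_right (abs_nonneg _) (by linarith)
      _ ≤ ‖u - v‖ := htri
  rw [dist_eq_norm, dist_eq_norm, hsub]
  refine abs_le_of_sq_le_sq' ?_ (by positivity) |>.2
  rw [norm_add_smul_sq e hp]
  have := sq_le_sq' (by linarith [neg_abs_le (√(1 - ‖u‖ ^ 2) - √(1 - ‖v‖ ^ 2))])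
    ((le_abs_self _).trans hdiff)
  nlinarith [norm_nonneg (u - v)]

theorem sphereGraph_mem_ball (hp : ‖p‖ = 1) {u : EuclideanSpace ℝ (Fin 2)} {r : ℝ} (hr : r ≤ 1)
    (hu : ‖u‖ < r / 2) : ‖sphereGraph p e u‖ = 1 ∧ dist (sphereGraph p e u) p < r := by
  have hnu := norm_nonneg u
  have hsu2 : √(1 - ‖u‖ ^ 2) ^ 2 = 1 - ‖u‖ ^ 2 := Real.sq_sqrt (by nlinarith)
  have hs0 := Real.sqrt_nonneg (1 - ‖u‖ ^ 2)
  refine ⟨?_, ?_⟩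
  · have := norm_add_smul_sq e hp u (√(1 - ‖u‖ ^ 2))
    rw [hsu2] at this
    have h2 : ‖sphereGraph p e u‖ ^ 2 = 1 := by rw [sphereGraph, this]; ring
    nlinarith [norm_nonneg (sphereGraph p e u)]
  · have hsub : sphereGraph p e u - p =
        (e u : EuclideanSpace ℝ (Fin 3)) + (√(1 - ‖u‖ ^ 2) - 1) • p := by
      simp only [sphereGraph, sub_smul, one_smul]; abel
    rw [dist_eq_norm, hsub]
    refine lt_of_pow_lt_pow_left₀ 2 (by linarith) ?_
    rw [norm_add_smul_sq e hp]
    set x := √(1 - ‖u‖ ^ 2)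
    have hx1 : x ≤ 1 := by nlinarith
    nlinarith

theorem exists_sphereGraph_eq (hp : ‖p‖ = 1) {x : EuclideanSpace ℝ (Fin 3)} (hx : ‖x‖ = 1)
    (hd : dist x p ≤ 1) : ∃ u, ‖u‖ ≤ dist x p ∧ sphereGraph p e u = x := by
  set u := e.symm ((Submodule.span ℝ {p})ᗮ.orthogonalProjectionOnto x) with hu
  have hdec : (e u : EuclideanSpace ℝ (Fin 3)) + inner ℝ p x • p = x := by
    have := Submodule.starProjection_add_starProjection_orthogonal (K := Submodule.span ℝ {p}) x
    rw [Submodule.starProjection_unit_singleton ℝ hp] at this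
    rw [add_comm, hu, LinearIsometryEquiv.apply_symm_apply]
    exact this
  have hn := norm_add_smul_sq e hp u (inner ℝ p x)
  rw [hdec, hx] at hn
  have hd2 : dist x p ^ 2 = 2 - 2 * inner ℝ p x := by
    rw [dist_eq_norm, norm_sub_sq_real, hx, hp, real_inner_comm]; ring
  have hd0 : 0 ≤ dist x p := dist_nonneg
  have hi : 0 ≤ inner ℝ p x := by nlinarith
  have hi1 : inner ℝ p x ≤ 1 := by nlinarith
  refine ⟨u, abs_le_of_sq_le_sq' (by nlinarith) hd0 |>.2, ?_⟩
  rw [sphereGraph, show 1 - ‖u‖ ^ 2 = inner ℝ p x ^ 2 by linarith, Real.sqrt_sq hi, hdec]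

/-- The area measure of the sphere is Ahlfors `2`-regular at small scales. -/
theorem sphereMeasure_regular : ∃ c C : ℝ≥0∞, c ≠ 0 ∧ c ≠ ⊤ ∧ C ≠ ⊤ ∧ ∀ (x : ↥Sphere2) (r : ℝ),
    0 < r → r ≤ 1 / 2 → c * ENNReal.ofReal r ^ 2 ≤ sphereMeasure (ball x r) ∧
      sphereMeasure (closedBall x r) ≤ C * ENNReal.ofReal r ^ 2 := by
  have hfin : ((Module.finrank ℝ (EuclideanSpace ℝ (Fin 2)) : ℕ) : ℝ) = 2 := by simp
  have hH : (μH[2] : Measure (EuclideanSpace ℝ (Fin 2))).IsAddHaarMeasure := by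
    rw [← hfin]; infer_instance
  set B := (μH[2] : Measure (EuclideanSpace ℝ (Fin 2))) (ball 0 1) with hB
  have hB0 : B ≠ 0 := (measure_ball_pos _ _ one_pos).ne'
  have hBt : B ≠ ⊤ := measure_ball_lt_top.ne
  refine ⟨ENNReal.ofReal (1 / 2) ^ 2 * B, 2 ^ 2 * B, by simp [hB0],
    ENNReal.mul_ne_top (by simp) hBt, ENNReal.mul_ne_top (by simp) hBt, fun x r hr0 hr => ?_⟩
  have hp : ‖(x : EuclideanSpace ℝ (Fin 3))‖ = 1 := by simpa [Sphere2] using x.2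
  obtain ⟨e⟩ := exists_linearIsometryEquiv_orthogonal hp
  constructor
  · have hLip : LipschitzWith 1 fun y : ↥Sphere2 =>
        e.symm ((Submodule.span ℝ {(x : EuclideanSpace ℝ (Fin 3))})ᗮ.orthogonalProjectionOnto y) := by
      have h1 := (Submodule.span ℝ {(x : EuclideanSpace ℝ (Fin 3))})ᗮ.orthogonalProjectionOnto
        |>.lipschitzWith_of_opNorm_le (K := 1)
          (by exact_mod_cast Submodule.orthogonalProjectionOnto_norm_le _)
      have h2 := (e.symm.lipschitz.comp h1).comp (LipschitzWith.subtype_val Sphere2)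
      rw [mul_one, mul_one] at h2
      exact h2
    have h := hLip.hausdorffMeasure_image_le (d := 2) zero_le_two (ball x r)
    simp only [ENNReal.coe_one, ENNReal.one_rpow, one_mul] at h
    refine le_trans ?_ h
    calc _ = (μH[2] : Measure (EuclideanSpace ℝ (Fin 2))) (ball 0 (r / 2)) := by
          rw [Measure.addHaar_ball _ _ (by linarith)]
          simp only [finrank_euclideanSpace, Fintype.card_fin]
          rw [← ENNReal.ofReal_pow (by norm_num), ← ENNReal.ofReal_pow hr0.le, mul_right_comm,
            ← ENNReal.ofReal_mul (by positivity)]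
          congr 2; ring
      _ ≤ _ := by
          refine measure_mono fun u hu => ?_
          have hG := sphereGraph_mem_ball (r := r) (u := u) e hp (by linarith) (by simpa using hu)
          refine ⟨⟨sphereGraph x e u, by simpa [Sphere2] using hG.1⟩, hG.2, ?_⟩
          rw [LinearIsometryEquiv.symm_apply_eq]
          have h0 : (Submodule.span ℝ {(x : EuclideanSpace ℝ (Fin 3))})ᗮ.orthogonalProjectionOnto
              (x : EuclideanSpace ℝ (Fin 3)) = 0 := by
            rw [Submodule.orthogonalProjectionOnto_eq_zero_iff, Submodule.orthogonal_orthogonal]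
            exact Submodule.mem_span_singleton_self _
          simp [sphereGraph, h0]
  · have hsub : ((↑) : ↥Sphere2 → EuclideanSpace ℝ (Fin 3)) '' closedBall x r ⊆
        sphereGraph x e '' closedBall 0 r := by
      rintro _ ⟨y, hy, rfl⟩
      have hy1 : dist (y : EuclideanSpace ℝ (Fin 3)) x ≤ r := hy
      obtain ⟨u, hu, hux⟩ := exists_sphereGraph_eq e hp (by simpa [Sphere2] using y.2)
        (by linarith : dist (y : EuclideanSpace ℝ (Fin 3)) x ≤ 1)
      exact ⟨u, by simpa using hu.trans hy1, hux⟩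
    have hLip : LipschitzOnWith 2 (sphereGraph (x : EuclideanSpace ℝ (Fin 3)) e) (closedBall 0 r) := by
      refine LipschitzOnWith.of_dist_le_mul fun u hu v hv => ?_
      exact dist_sphereGraph_le e hp (by simpa using (mem_closedBall_zero_iff.1 hu).trans hr)
        (by simpa using (mem_closedBall_zero_iff.1 hv).trans hr)
    have h := hLip.hausdorffMeasure_image_le (d := 2) zero_le_two
    rw [Measure.addHaar_closedBall _ _ hr0.le] at h
    have hiso := (isometry_subtype_coe (s := Sphere2)).hausdorffMeasure_image
      (Or.inl zero_le_two) (closedBall x r) (d := 2)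
    rw [sphereMeasure, ← hiso]
    refine (measure_mono hsub).trans (h.trans_eq ?_)
    simp only [finrank_euclideanSpace, Fintype.card_fin]
    rw [← ENNReal.ofReal_pow hr0.le, ← hB]
    norm_num
    ring

instance compactSpace_sphere2 : CompactSpace ↥Sphere2 :=
  isCompact_iff_compactSpace.1 (isCompact_sphere _ _)

instance isFiniteMeasure_sphereMeasure : IsFiniteMeasure sphereMeasure := by
  obtain ⟨c, C, -, -, hC, h⟩ := sphereMeasure_regular
  have : IsLocallyFiniteMeasure sphereMeasure := ⟨fun x =>
    ⟨closedBall x (1 / 2), closedBall_mem_nhds _ (by norm_num),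
      ((h x (1 / 2) (by norm_num) le_rfl).2).trans_lt
        (ENNReal.mul_lt_top hC.lt_top (by finiteness))⟩⟩
  exact ⟨isCompact_univ.measure_lt_top⟩

end SphereRegularity

section Covering

variable {X : Type*} [MetricSpace X] [MeasurableSpace X]

theorem exists_doubling_radius {κ : ℝ≥0∞} (hκ : κ ≠ 0) (ν : Measure X) [IsFiniteMeasure ν] (x : X)
    {r₀ : ℝ} (hr₀ : 0 < r₀)
    (hlow : ∀ r, 0 < r → r ≤ r₀ → κ * ENNReal.ofReal r ^ 2 ≤ ν (closedBall x r))
    {M : ℝ} (hM : 1 ≤ M) {ε : ℝ} (hε : 0 < ε) :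
    ∃ s, 0 < s ∧ s < ε ∧
      ν (closedBall x (M * s)) ≤ (2 * ENNReal.ofReal M ^ 2) * ν (closedBall x s) := by
  by_contra! hcon
  have hM0 : 0 < M := by linarith
  set s₀ := min ε r₀ / 2 with hs₀
  have hs0 : 0 < s₀ := half_pos (lt_min hε hr₀)
  have hsr : s₀ ≤ r₀ := by have := min_le_right ε r₀; linarith
  have hse : s₀ < ε := by have := min_le_left ε r₀; linarith
  have hsn : ∀ n : ℕ, 0 < s₀ / M ^ n ∧ s₀ / M ^ n ≤ s₀ := fun n =>
    ⟨by positivity, div_le_self hs0.le (one_le_pow₀ hM)⟩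
  have hind : ∀ n : ℕ, (2 * ENNReal.ofReal M ^ 2) ^ n * ν (closedBall x (s₀ / M ^ n)) ≤ ν univ := by
    intro n
    induction n with
    | zero => simpa using measure_mono (subset_univ _)
    | succ n ih =>
      refine le_trans ?_ ih
      rw [pow_succ, mul_assoc]
      gcongr
      have h := hcon _ (hsn (n + 1)).1 ((hsn (n + 1)).2.trans_lt hse)
      refine h.le.trans_eq ?_
      congr 2
      field_simp
      rw [pow_succ']
  have hpow : ∀ n : ℕ, 2 ^ n * (κ * ENNReal.ofReal s₀ ^ 2) ≤ ν univ := by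
    intro n
    refine le_trans (le_of_eq ?_) ((mul_le_mul_right (hlow _ (hsn n).1 ((hsn n).2.trans hsr)) _).trans
      (hind n))
    have h1 : ENNReal.ofReal s₀ = ENNReal.ofReal M ^ n * ENNReal.ofReal (s₀ / M ^ n) := by
      rw [← ENNReal.ofReal_pow hM0.le, ← ENNReal.ofReal_mul (by positivity)]
      congr 1
      field_simp
    rw [h1]
    ring
  have hne : κ * ENNReal.ofReal s₀ ^ 2 ≠ 0 :=
    mul_ne_zero hκ (pow_ne_zero _ (ENNReal.ofReal_pos.2 hs0).ne')
  have htop : Tendsto (fun n : ℕ => (2 : ℝ≥0∞) ^ n * (κ * ENNReal.ofReal s₀ ^ 2)) atTop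
      (𝓝 (⊤ * (κ * ENNReal.ofReal s₀ ^ 2))) :=
    ENNReal.Tendsto.mul_const (ENNReal.tendsto_pow_atTop_nhds_top_iff.2 (by norm_num))
      (Or.inl ENNReal.top_ne_zero)
  rw [ENNReal.top_mul hne] at htop
  exact measure_ne_top ν univ (top_le_iff.1 (le_of_tendsto' htop hpow))

theorem ENNReal.mul_le_sq_add_sq (x y : ℝ≥0∞) : x * y ≤ x ^ 2 + y ^ 2 := by
  rcases le_total x y with h | h
  · calc x * y ≤ y * y := by gcongr
      _ ≤ x ^ 2 + y ^ 2 := by rw [← sq]; exact le_add_self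
  · calc x * y ≤ x * x := by gcongr
      _ ≤ x ^ 2 + y ^ 2 := by rw [← sq]; exact le_self_add

variable [BorelSpace X] {ι : Type*} [Countable ι] {σ ν : Measure X} {c C K : ℝ≥0∞}
  {x : ι → X} {s : ι → ℝ} {w : ι → ℝ≥0∞}

/-- A weighted sum of indicators of the dilated balls `closedBall (x i) (10 * s i)`. -/
noncomputable def ballDensity (x : ι → X) (s : ι → ℝ) (w : ι → ℝ≥0∞) (y : X) : ℝ≥0∞ :=
  ∑' i, (closedBall (x i) (10 * s i)).indicator (fun _ => w i / ENNReal.ofReal (s i)) y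

theorem measurable_ballDensity : Measurable (ballDensity x s w) :=
  Measurable.tsum fun _ => measurable_const.indicator isClosed_closedBall.measurableSet

theorem lintegral_ballDensity_sq_le (hc : c ≠ 0) (hct : c ≠ ⊤)
    (hlow : ∀ y r, 0 < r → r ≤ 1 / 2 → c * ENNReal.ofReal r ^ 2 ≤ σ (closedBall y r))
    (hup : ∀ y r, 0 < r → r ≤ 1 / 2 → σ (closedBall y r) ≤ C * ENNReal.ofReal r ^ 2)
    (hs : ∀ i, 0 < s i) (hs' : ∀ i, 21 * s i ≤ 1 / 2)
    (hdisj : Pairwise (Function.onFun Disjoint fun i => closedBall (x i) (s i)))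
    (hw : ∀ i, w i ^ 2 = ν (closedBall (x i) (s i)))
    (hdoub : ∀ i, ν (closedBall (x i) (21 * s i)) ≤ K * ν (closedBall (x i) (s i))) :
    ∫⁻ y, ballDensity x s w y ^ 2 ∂σ ≤
      2 * (100 * C * (K + 441 * C / c)) * ∑' i, ν (closedBall (x i) (s i)) := by
  classical
  set b : ι → X → ℝ≥0∞ := fun i =>
    (closedBall (x i) (10 * s i)).indicator (fun _ => w i / ENNReal.ofReal (s i)) with hb
  have hbm : ∀ i, Measurable (b i) := fun i =>
    measurable_const.indicator isClosed_closedBall.measurableSet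
  set P : ι → ι → ℝ≥0∞ := fun i j => if s j ≤ s i then ∫⁻ y, b i y * b j y ∂σ else 0 with hP
  have hS0 : ∀ i, ENNReal.ofReal (s i) ≠ 0 := fun i => (ENNReal.ofReal_pos.2 (hs i)).ne'
  have hSt : ∀ i, ENNReal.ofReal (s i) ≠ ⊤ := fun i => ENNReal.ofReal_ne_top
  have hsq : ∫⁻ y, ballDensity x s w y ^ 2 ∂σ = ∑' i, ∑' j, ∫⁻ y, b i y * b j y ∂σ := by
    have h1 : ∀ y, ballDensity x s w y ^ 2 = ∑' i, ∑' j, b i y * b j y := by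
      intro y
      simp only [ENNReal.tsum_mul_left, ENNReal.tsum_mul_right]
      rw [sq]; rfl
    simp_rw [h1]
    have h2 : ∀ i, Measurable fun y => ∑' j, b i y * b j y := fun i =>
      Measurable.tsum fun j => (hbm i).mul (hbm j)
    rw [lintegral_tsum fun i => (h2 i).aemeasurable]
    refine tsum_congr fun i => ?_
    exact lintegral_tsum fun j => ((hbm i).mul (hbm j)).aemeasurable
  have hsplit : ∑' i, ∑' j, ∫⁻ y, b i y * b j y ∂σ ≤ 2 * ∑' i, ∑' j, P i j := by
    calc _ ≤ ∑' i, ∑' j, (P i j + P j i) := by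
          refine ENNReal.tsum_le_tsum fun i => ENNReal.tsum_le_tsum fun j => ?_
          simp only [hP]
          rcases le_total (s j) (s i) with h | h
          · rw [if_pos h]; exact le_self_add
          · rw [if_pos h]; simp only [mul_comm (b i _)]; exact le_add_self
      _ = ∑' i, ∑' j, P i j + ∑' i, ∑' j, P j i := by
          simp only [ENNReal.tsum_add]
      _ = 2 * ∑' i, ∑' j, P i j := by
          rw [ENNReal.tsum_comm (f := fun i j => P j i), two_mul]
  have hPle : ∀ i j, P i j ≤ 100 * C *
      (if closedBall (x j) (s j) ⊆ closedBall (x i) (21 * s i) then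
        w j ^ 2 + (w i * ENNReal.ofReal (s j) / ENNReal.ofReal (s i)) ^ 2 else 0) := by
    intro i j
    simp only [hP]
    by_cases hji : s j ≤ s i
    swap
    · rw [if_neg hji]; exact zero_le
    rw [if_pos hji]
    by_cases hne : (closedBall (x i) (10 * s i) ∩ closedBall (x j) (10 * s j)).Nonempty
    swap
    · have hz : ∀ y, b i y * b j y = 0 := by
        intro y
        by_cases hi : y ∈ closedBall (x i) (10 * s i)
        · have hj : y ∉ closedBall (x j) (10 * s j) := fun hj => hne ⟨y, hi, hj⟩
          simp only [hb, indicator_of_notMem hj, mul_zero]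
        · simp only [hb, indicator_of_notMem hi, zero_mul]
      simp only [hz, lintegral_zero]; exact zero_le
    obtain ⟨z, hzi, hzj⟩ := hne
    have hmem : closedBall (x j) (s j) ⊆ closedBall (x i) (21 * s i) := by
      refine closedBall_subset_closedBall' ?_
      rw [mem_closedBall] at hzi hzj
      have := dist_triangle_left (x j) (x i) z
      linarith [hs i]
    rw [if_pos hmem]
    calc ∫⁻ y, b i y * b j y ∂σ
        ≤ ∫⁻ y, (w i / ENNReal.ofReal (s i)) * b j y ∂σ := by
          refine lintegral_mono fun y => ?_
          gcongr
          exact indicator_le_self' (fun _ _ => zero_le) _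
      _ = (w i / ENNReal.ofReal (s i)) * ((w j / ENNReal.ofReal (s j)) *
            σ (closedBall (x j) (10 * s j))) := by
          rw [lintegral_const_mul _ (hbm j)]
          simp only [hb]
          rw [lintegral_indicator_const isClosed_closedBall.measurableSet]
      _ ≤ (w i / ENNReal.ofReal (s i)) * ((w j / ENNReal.ofReal (s j)) *
            (C * (10 * ENNReal.ofReal (s j)) ^ 2)) := by
          gcongr
          refine (hup _ _ (by linarith [hs j]) (by linarith [hs j, hs' j])).trans_eq ?_
          rw [ENNReal.ofReal_mul (by norm_num)]; norm_num
      _ = 100 * C * (w j * (w i * ENNReal.ofReal (s j) / ENNReal.ofReal (s i))) := by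
          have h1 : w j / ENNReal.ofReal (s j) * (C * (10 * ENNReal.ofReal (s j)) ^ 2) =
              (ENNReal.ofReal (s j) / ENNReal.ofReal (s j)) *
                (100 * C * (w j * ENNReal.ofReal (s j))) := by
            simp only [div_eq_mul_inv]; ring
          rw [h1, ENNReal.div_self (hS0 j) (hSt j)]
          simp only [div_eq_mul_inv]; ring
      _ ≤ 100 * C * (w j ^ 2 + (w i * ENNReal.ofReal (s j) / ENNReal.ofReal (s i)) ^ 2) := by
          gcongr
          exact ENNReal.mul_le_sq_add_sq _ _
  have hsum : ∀ (τ : Measure X) (i : ι), ∑' j, (if closedBall (x j) (s j) ⊆ closedBall (x i) (21 * s i)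
      then τ (closedBall (x j) (s j)) else 0) ≤ τ (closedBall (x i) (21 * s i)) := by
    intro τ i
    calc _ ≤ ∑' j, τ.restrict (closedBall (x i) (21 * s i)) (closedBall (x j) (s j)) := by
          refine ENNReal.tsum_le_tsum fun j => ?_
          split_ifs with h
          · rw [Measure.restrict_apply isClosed_closedBall.measurableSet, inter_eq_left.2 h]
          · exact zero_le
      _ = τ.restrict (closedBall (x i) (21 * s i)) (⋃ j, closedBall (x j) (s j)) :=
          (measure_iUnion hdisj fun j => isClosed_closedBall.measurableSet).symm
      _ ≤ τ.restrict (closedBall (x i) (21 * s i)) univ := measure_mono (subset_univ _)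
      _ = _ := by rw [Measure.restrict_apply_univ]
  have hrow : ∀ i, ∑' j, P i j ≤ 100 * C * (K + 441 * C / c) * ν (closedBall (x i) (s i)) := by
    intro i
    refine (ENNReal.tsum_le_tsum (hPle i)).trans ?_
    rw [ENNReal.tsum_mul_left, mul_assoc (100 * C)]
    gcongr
    have hS2 : ∑' j, (if closedBall (x j) (s j) ⊆ closedBall (x i) (21 * s i)
        then ENNReal.ofReal (s j) ^ 2 else 0) ≤ 441 * C / c * ENNReal.ofReal (s i) ^ 2 := by
      have h3 : c * ∑' j, (if closedBall (x j) (s j) ⊆ closedBall (x i) (21 * s i)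
        then ENNReal.ofReal (s j) ^ 2 else 0) ≤ 441 * C * ENNReal.ofReal (s i) ^ 2 := by
        rw [← ENNReal.tsum_mul_left]
        refine (ENNReal.tsum_le_tsum fun j => ?_).trans ((hsum σ i).trans
          ((hup _ _ (by linarith [hs i]) (hs' i)).trans_eq ?_))
        · split_ifs
          · exact hlow _ _ (hs j) (by linarith [hs j, hs' j])
          · simp
        · rw [ENNReal.ofReal_mul (by norm_num), mul_pow]; norm_num; ring
      rw [mul_comm, ← ENNReal.le_div_iff_mul_le (Or.inl hc) (Or.inl hct)] at h3
      refine h3.trans_eq ?_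
      simp only [div_eq_mul_inv]; ring
    calc _ ≤ ∑' j, ((if closedBall (x j) (s j) ⊆ closedBall (x i) (21 * s i)
            then ν (closedBall (x j) (s j)) else 0) +
          (w i / ENNReal.ofReal (s i)) ^ 2 * (if closedBall (x j) (s j) ⊆ closedBall (x i) (21 * s i)
            then ENNReal.ofReal (s j) ^ 2 else 0)) := by
          refine ENNReal.tsum_le_tsum fun j => ?_
          split_ifs
          · rw [hw]; gcongr; apply le_of_eq; simp only [div_eq_mul_inv]; ring
          · exact zero_le
      _ ≤ ν (closedBall (x i) (21 * s i)) +
          (w i / ENNReal.ofReal (s i)) ^ 2 * (441 * C / c * ENNReal.ofReal (s i) ^ 2) := by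
          rw [ENNReal.tsum_add, ENNReal.tsum_mul_left]
          gcongr
          exact hsum ν i
      _ ≤ K * ν (closedBall (x i) (s i)) + 441 * C / c * ν (closedBall (x i) (s i)) := by
          refine add_le_add (hdoub i) (le_of_eq ?_)
          rw [← hw, mul_left_comm, ← mul_pow, ENNReal.div_mul_cancel (hS0 i) (hSt i)]
      _ = _ := by rw [add_mul]
  rw [hsq]
  refine hsplit.trans ?_
  rw [mul_assoc 2]
  gcongr
  rw [← ENNReal.tsum_mul_left]
  exact ENNReal.tsum_le_tsum hrow

end Covering

section CurveLength

theorem exists_first_hit {g : ℝ → ℝ} (hg : Continuous g) {t₀ d a : ℝ} (htd : t₀ ≤ d)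
    (h₀ : g t₀ < a) (hd : a ≤ g d) :
    ∃ τ ∈ Icc t₀ d, g τ = a ∧ ∀ t ∈ Icc t₀ τ, g t ≤ a := by
  set T := Icc t₀ d ∩ g ⁻¹' {a} with hT
  have hTc : IsCompact T := isCompact_Icc.inter_right (isClosed_singleton.preimage hg)
  have hTne : T.Nonempty := by
    obtain ⟨t, ht, hta⟩ := intermediate_value_Icc htd hg.continuousOn ⟨h₀.le, hd⟩
    exact ⟨t, ht, hta⟩
  obtain ⟨τ, hτ, hmin⟩ := hTc.exists_isLeast hTne
  refine ⟨τ, hτ.1, hτ.2, fun t ht => ?_⟩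
  by_contra! hlt
  obtain ⟨u, hu, hua⟩ := intermediate_value_Icc ht.1 hg.continuousOn ⟨h₀.le, hlt.le⟩
  have h1 : τ ≤ u := hmin ⟨⟨hu.1, hu.2.trans (ht.2.trans hτ.1.2)⟩, hua⟩
  have h2 : t = τ := le_antisymm ht.2 (h1.trans hu.2)
  have h3 : g τ = a := hτ.2
  rw [h2] at hlt
  linarith

variable {X : Type*} [MetricSpace X]

theorem le_measure_inter_closedBall {p : ℝ → X} (hp : Continuous p) {m : Measure ℝ}
    (hm : ∀ c d, c ≤ d → edist (p c) (p d) ≤ m (Icc c d)) {c d : ℝ} {x : X} {s : ℝ} (hs : 0 < s)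
    (hcd : 20 * s < dist (p c) (p d)) {t₀ : ℝ} (ht₀ : t₀ ∈ Icc c d)
    (hx : p t₀ ∈ closedBall x (5 * s)) :
    ENNReal.ofReal (5 * s) ≤ m (Icc c d ∩ p ⁻¹' closedBall x (10 * s)) := by
  have hg : Continuous fun t => dist (p t) x := hp.dist continuous_const
  have hlow : ∀ τ, dist (p τ) x = 10 * s → ENNReal.ofReal (5 * s) ≤ edist (p t₀) (p τ) := by
    intro τ hτ
    rw [edist_dist]
    refine ENNReal.ofReal_le_ofReal ?_
    have := dist_triangle_left (p τ) x (p t₀)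
    rw [mem_closedBall] at hx
    linarith
  have hx5 : dist (p t₀) x < 10 * s := by rw [mem_closedBall] at hx; linarith
  rcases lt_or_ge (10 * s) (dist (p d) x) with h | h
  · obtain ⟨τ, hτ, hτa, hin⟩ := exists_first_hit hg ht₀.2 hx5 h.le
    refine (hlow τ hτa).trans ((hm _ _ hτ.1).trans (measure_mono fun t ht => ?_))
    exact ⟨⟨ht₀.1.trans ht.1, ht.2.trans hτ.2⟩, hin t ht⟩
  · have h' : 10 * s < dist (p c) x := by
      have := dist_triangle_right (p c) (p d) x
      linarith
    have hg' : Continuous fun t => dist (p (-t)) x := hg.comp continuous_neg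
    obtain ⟨τ, hτ, hτa, hin⟩ := exists_first_hit (g := fun t => dist (p (-t)) x) hg' (t₀ := -t₀)
      (d := -c) (neg_le_neg ht₀.1) (by simpa using hx5) (by simpa using h'.le)
    refine (hlow (-τ) hτa).trans ?_
    rw [edist_comm]
    refine (hm _ _ (by linarith [hτ.1])).trans (measure_mono fun t ht => ?_)
    refine ⟨⟨by linarith [hτ.2, ht.1], ht.2.trans ht₀.2⟩, ?_⟩
    simpa using hin (-t) ⟨neg_le_neg ht.2, by linarith [ht.1]⟩

variable {Y : Type*} [MetricSpace Y] {ι : Type*} [Countable ι] {x : ι → X} {s : ι → ℝ}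
  {w : ι → ℝ≥0∞}

theorem edist_le_tsum_of_cover {q : ℝ → Y} {c d : ℝ} (hcd : c ≤ d) (hq : ContinuousOn q (Icc c d))
    {y : ι → Y} {R : ι → ℝ≥0∞} (hcov : ∀ t ∈ Icc c d, ∃ i, edist (y i) (q t) ≤ R i) :
    edist (q c) (q d) ≤ ∑' i, 2 * R i := by
  have hr : ContinuousOn (fun t => dist (q c) (q t)) (Icc c d) := by fun_prop
  have hsub : Icc 0 (dist (q c) (q d)) ⊆ ⋃ i, closedEBall (dist (q c) (y i)) (R i) := by
    intro v hv
    have := intermediate_value_Icc hcd hr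
    simp only [dist_self] at this
    obtain ⟨t, ht, rfl⟩ := this hv
    obtain ⟨i, hi⟩ := hcov t ht
    refine mem_iUnion.2 ⟨i, ?_⟩
    refine le_trans ?_ hi
    rw [edist_dist, edist_dist, Real.dist_eq]
    refine ENNReal.ofReal_le_ofReal ?_
    rw [dist_comm (y i), dist_comm (q c) (y i)]
    change |dist (q c) (q t) - _| ≤ _
    rw [dist_comm (q c) (q t)]
    exact abs_dist_sub_le _ _ _
  calc edist (q c) (q d) = volume (Icc 0 (dist (q c) (q d))) := by
        rw [Real.volume_Icc, edist_dist, sub_zero]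
    _ ≤ ∑' i, volume (closedEBall (dist (q c) (y i)) (R i)) :=
        (measure_mono hsub).trans (measure_iUnion_le _)
    _ = _ := by simp

variable [MeasurableSpace X] [BorelSpace X]

theorem edist_le_lintegral_ballDensity {p : ℝ → X} (hp : Continuous p) {m : Measure ℝ}
    (hm : ∀ c d, c ≤ d → edist (p c) (p d) ≤ m (Icc c d)) {c d : ℝ} (hcd : c ≤ d)
    (hs : ∀ i, 0 < s i) (hs' : ∀ i, 20 * s i < dist (p c) (p d)) {φ : X → Y}
    (hq : ContinuousOn (fun t => φ (p t)) (Icc c d))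
    (hcov : ∀ t ∈ Icc c d, ∃ i, p t ∈ closedBall (x i) (5 * s i)) {L : ℝ≥0∞}
    (hφ : ∀ i, ∀ z ∈ closedBall (x i) (5 * s i), edist (φ (x i)) (φ z) ≤ L * w i) :
    edist (φ (p c)) (φ (p d)) ≤ L * ∫⁻ t in Icc c d, ballDensity x s w (p t) ∂m := by
  set J : Set ι := {i | ∃ t ∈ Icc c d, p t ∈ closedBall (x i) (5 * s i)} with hJ
  have h1 : edist (φ (p c)) (φ (p d)) ≤ ∑' i : J, 2 * (L * w i) := by
    refine edist_le_tsum_of_cover (q := fun t => φ (p t)) (y := fun i : J => φ (x i)) hcd hq ?_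
    intro t ht
    obtain ⟨i, hi⟩ := hcov t ht
    exact ⟨⟨i, t, ht, hi⟩, hφ i _ hi⟩
  have hbm : ∀ i, Measurable fun t => (closedBall (x i) (10 * s i)).indicator
      (fun _ => w i / ENNReal.ofReal (s i)) (p t) := fun i =>
    (measurable_const.indicator isClosed_closedBall.measurableSet).comp hp.measurable
  have h2 : ∑' i : J, 5 * w i ≤ ∫⁻ t in Icc c d, ballDensity x s w (p t) ∂m := by
    unfold ballDensity
    rw [lintegral_tsum fun i => (hbm i).aemeasurable]
    refine le_trans ?_ (ENNReal.tsum_comp_le_tsum_of_injective (Subtype.val_injective (p := (· ∈ J))) _)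
    refine ENNReal.tsum_le_tsum fun i => ?_
    obtain ⟨i, t₀, ht₀, hx⟩ := i
    have hle := le_measure_inter_closedBall hp hm (hs i) (hs' i) ht₀ hx
    have hmeas : MeasurableSet (p ⁻¹' closedBall (x i) (10 * s i)) :=
      (isClosed_closedBall.preimage hp).measurableSet
    have heq : ∫⁻ t in Icc c d, (closedBall (x i) (10 * s i)).indicator
        (fun _ => w i / ENNReal.ofReal (s i)) (p t) ∂m =
        w i / ENNReal.ofReal (s i) * m (Icc c d ∩ p ⁻¹' closedBall (x i) (10 * s i)) := by
      have : (fun t => (closedBall (x i) (10 * s i)).indicator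
        (fun _ => w i / ENNReal.ofReal (s i)) (p t)) = (p ⁻¹' closedBall (x i) (10 * s i)).indicator
        (fun _ => w i / ENNReal.ofReal (s i)) := by
        ext t; simp [indicator, mem_preimage]
      rw [this, lintegral_indicator_const hmeas, Measure.restrict_apply hmeas, inter_comm]
    rw [heq]
    calc 5 * w i = w i / ENNReal.ofReal (s i) * ENNReal.ofReal (5 * s i) := by
          rw [ENNReal.ofReal_mul (by norm_num), mul_left_comm,
            ENNReal.div_mul_cancel (ENNReal.ofReal_pos.2 (hs i)).ne' ENNReal.ofReal_ne_top]
          norm_num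
      _ ≤ _ := by gcongr
  refine h1.trans (le_trans ?_ (mul_le_mul_right h2 L))
  rw [← ENNReal.tsum_mul_left]
  refine ENNReal.tsum_le_tsum fun i => ?_
  rw [mul_left_comm]
  gcongr
  norm_num

end CurveLength

section ScaleDensity

variable {X Y : Type*} [MetricSpace X] [MeasurableSpace X] [MetricSpace Y]

/-- `v` controls the oscillation of `φ` along curves in `dom` at scales above `ε`, and its energy is
dominated by `μ` up to an error of size `ε`. -/
structure IsScaleDensity (σ μ : Measure X) (dom : Set X) (φ : X → Y) (B L : ℝ≥0∞) (ε : ℝ)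
    (v : X → ℝ≥0∞) : Prop where
  measurable : Measurable v
  energy_le : ∀ K U : Set X, IsClosed K → thickening ε K ⊆ U →
    ∫⁻ y in K, v y ^ 2 ∂σ ≤ B * (μ U + ENNReal.ofReal ε * σ U)
  edist_le : ∀ (p : ℝ → X) (m : Measure ℝ), Continuous p → (∀ t, p t ∈ dom) →
    (∀ c d, c ≤ d → edist (p c) (p d) ≤ m (Icc c d)) → ∀ c d, c ≤ d → ε ≤ dist (p c) (p d) →
      edist (φ (p c)) (φ (p d)) ≤ L * ∫⁻ t in Icc c d, v (p t) ∂m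

theorem IsScaleDensity.mono {σ μ : Measure X} {dom : Set X} {φ : X → Y} {B L : ℝ≥0∞} {ε ε' : ℝ}
    {v : X → ℝ≥0∞} (h : IsScaleDensity σ μ dom φ B L ε v) (hε : ε ≤ ε') :
    IsScaleDensity σ μ dom φ B L ε' v where
  measurable := h.measurable
  energy_le K U hK hU := by
    refine (h.energy_le K U hK ((thickening_mono hε K).trans hU)).trans ?_
    gcongr
  edist_le p m hp hd hm c d hcd hdist := h.edist_le p m hp hd hm c d hcd (hε.trans hdist)

theorem ENNReal.half_add_sq_le (a b : ℝ≥0∞) : ((a + b) / 2) ^ 2 ≤ (a ^ 2 + b ^ 2) / 2 := by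
  rcases eq_or_ne a ⊤ with rfl | ha
  · simp [ENNReal.top_div]
  rcases eq_or_ne b ⊤ with rfl | hb
  · simp [ENNReal.top_div]
  lift a to ℝ≥0 using ha
  lift b to ℝ≥0 using hb
  have : ((a + b) / 2) ^ 2 ≤ (a ^ 2 + b ^ 2) / 2 := by
    rw [← NNReal.coe_le_coe]
    push_cast
    nlinarith [sq_nonneg ((a : ℝ) - b)]
  have h2 : (2 : ℝ≥0∞) = ((2 : ℝ≥0) : ℝ≥0∞) := rfl
  rw [h2, ← ENNReal.coe_add, ← ENNReal.coe_div two_ne_zero, ← ENNReal.coe_pow, ← ENNReal.coe_pow,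
    ← ENNReal.coe_pow, ← ENNReal.coe_add, ← ENNReal.coe_div two_ne_zero]
  exact_mod_cast this

theorem IsScaleDensity.midpoint [BorelSpace X] {σ μ : Measure X} {dom : Set X} {φ : X → Y} {B L : ℝ≥0∞} {ε : ℝ}
    {u v : X → ℝ≥0∞} (hu : IsScaleDensity σ μ dom φ B L ε u)
    (hv : IsScaleDensity σ μ dom φ B L ε v) :
    IsScaleDensity σ μ dom φ B L ε fun y => (u y + v y) / 2 where
  measurable := (hu.measurable.add hv.measurable).div_const 2
  energy_le K U hK hU := by
    have hum := hu.measurable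
    have hvm := hv.measurable
    calc ∫⁻ y in K, ((u y + v y) / 2) ^ 2 ∂σ ≤ ∫⁻ y in K, (u y ^ 2 + v y ^ 2) / 2 ∂σ :=
          lintegral_mono fun y => ENNReal.half_add_sq_le _ _
      _ = (∫⁻ y in K, u y ^ 2 ∂σ + ∫⁻ y in K, v y ^ 2 ∂σ) / 2 := by
          simp only [div_eq_mul_inv]
          rw [lintegral_mul_const _ (by fun_prop), lintegral_add_left (by fun_prop)]
      _ ≤ (B * (μ U + ENNReal.ofReal ε * σ U) + B * (μ U + ENNReal.ofReal ε * σ U)) / 2 := by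
          gcongr
          · exact hu.energy_le K U hK hU
          · exact hv.energy_le K U hK hU
      _ = _ := by rw [ENNReal.add_div, ENNReal.add_halves]
  edist_le p m hp hd hm c d hcd hdist := by
    have hum := hu.measurable
    have hvm := hv.measurable
    have hpm := hp.measurable
    have h1 := hu.edist_le p m hp hd hm c d hcd hdist
    have h2 := hv.edist_le p m hp hd hm c d hcd hdist
    calc edist (φ (p c)) (φ (p d)) = (edist (φ (p c)) (φ (p d)) + edist (φ (p c)) (φ (p d))) / 2 := by
          rw [ENNReal.add_div, ENNReal.add_halves]
      _ ≤ (L * ∫⁻ t in Icc c d, u (p t) ∂m + L * ∫⁻ t in Icc c d, v (p t) ∂m) / 2 := by gcongr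
      _ = _ := by
          simp only [div_eq_mul_inv]
          rw [lintegral_mul_const _ (by fun_prop), lintegral_add_left (by fun_prop)]
          ring

theorem exists_isScaleDensity [BorelSpace X] [TopologicalSpace.SeparableSpace X]
    {σ μ : Measure X} [IsFiniteMeasure σ] [IsFiniteMeasure μ] {dom : Set X} {φ : X → Y} {c C : ℝ≥0∞}
    (hc : c ≠ 0) (hct : c ≠ ⊤) (hC : C ≠ ⊤)
    (hlow : ∀ y r, 0 < r → r ≤ 1 / 2 → c * ENNReal.ofReal r ^ 2 ≤ σ (closedBall y r))
    (hup : ∀ y r, 0 < r → r ≤ 1 / 2 → σ (closedBall y r) ≤ C * ENNReal.ofReal r ^ 2)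
    (hφ : ContinuousOn φ dom) {Q : ℝ≥0∞} (hQt : Q ≠ ⊤) {A : ℝ}
    (hQ : ∀ x ∈ dom, ∃ s₀ > 0, ∀ s, 0 < s → s < s₀ → ∀ z ∈ closedBall x s,
      edist (φ x) (φ z) ^ 2 ≤ Q * μ (closedBall x (A * s))) :
    ∃ B L : ℝ≥0∞, B ≠ ⊤ ∧ L ≠ ⊤ ∧ ∀ ε > 0, ∃ v, IsScaleDensity σ μ dom φ B L ε v := by
  set M : ℝ := max 21 (5 * A) with hM
  have hM21 : 21 ≤ M := le_max_left _ _
  have hMA : 5 * A ≤ M := le_max_right _ _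
  set K : ℝ≥0∞ := 2 * ENNReal.ofReal M ^ 2 with hK
  have hKt : K ≠ ⊤ := by finiteness
  have hsqrt : ∀ a : ℝ≥0∞, (a ^ (1 / 2 : ℝ)) ^ 2 = a := fun a => by
    rw [← ENNReal.rpow_natCast, ← ENNReal.rpow_mul]; norm_num
  refine ⟨2 * (100 * C * (K + 441 * C / c)), (Q * K) ^ (1 / 2 : ℝ), by finiteness,
    ENNReal.rpow_ne_top_of_nonneg (by norm_num) (by finiteness), fun ε hε => ?_⟩
  set ν : Measure X := μ + ENNReal.ofReal ε • σ with hν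
  have hνfin : IsFiniteMeasure ν := ⟨by
    have h1 : μ univ ≠ ⊤ := by finiteness
    have h2 : σ univ ≠ ⊤ := by finiteness
    rw [hν, Measure.add_apply, Measure.smul_apply, smul_eq_mul, lt_top_iff_ne_top]
    finiteness⟩
  have hνlow : ∀ y r, 0 < r → r ≤ 1 / 2 →
      (ENNReal.ofReal ε * c) * ENNReal.ofReal r ^ 2 ≤ ν (closedBall y r) := by
    intro y r h0 h1
    rw [hν, Measure.add_apply, Measure.smul_apply, smul_eq_mul, mul_assoc]
    exact (mul_le_mul_right (hlow y r h0 h1) _).trans le_add_self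
  have hμν : ∀ E, μ E ≤ ν E := fun E => by
    rw [hν, Measure.add_apply]; exact le_self_add
  have hex : ∀ x : dom, ∃ s, 0 < s ∧ 21 * s ≤ 1 / 2 ∧ 21 * s < ε ∧
      ν (closedBall x (M * s)) ≤ K * ν (closedBall x s) ∧
      ∀ z ∈ closedBall (x : X) (5 * s), edist (φ x) (φ z) ^ 2 ≤ Q * μ (closedBall x (M * s)) := by
    rintro ⟨x, hx⟩
    obtain ⟨s₀, hs₀, hQx⟩ := hQ x hx
    have hpos : 0 < min (min (1 / 42) (ε / 21)) (s₀ / 5) := by positivity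
    obtain ⟨s, hs, hlt, hd⟩ := exists_doubling_radius (mul_ne_zero (ENNReal.ofReal_pos.2 hε).ne' hc)
      ν x (by norm_num : (0:ℝ) < 1 / 2) (hνlow x) (by linarith : 1 ≤ M) hpos
    rw [lt_min_iff, lt_min_iff] at hlt
    refine ⟨s, hs, by linarith, by linarith, hd, fun z hz => ?_⟩
    refine (hQx (5 * s) (by linarith) (by linarith) z hz).trans ?_
    gcongr Q * μ ?_
    exact closedBall_subset_closedBall (by nlinarith)
  choose s hs hs1 hs2 hs3 hs4 using hex
  obtain ⟨u, -, hdisj, hcov⟩ := Vitali.exists_disjoint_subfamily_covering_enlargement_closedBall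
    (univ : Set dom) (fun x => (x : X)) s (1 / 42) (fun x _ => by linarith [hs1 x]) 5 (by norm_num)
  have hu : u.Countable := hdisj.countable_of_nonempty_interior fun i _ =>
    ⟨i, mem_interior.2 ⟨ball i (s i), ball_subset_closedBall, isOpen_ball, mem_ball_self (hs i)⟩⟩
  have : Countable u := hu.to_subtype
  set x' : u → X := fun i => (i : dom) with hx'
  set s' : u → ℝ := fun i => s i with hs'
  set w : u → ℝ≥0∞ := fun i => ν (closedBall (x' i) (s' i)) ^ (1 / 2 : ℝ) with hw
  have hdisj' : Pairwise (Function.onFun Disjoint fun i : u => closedBall (x' i) (s' i)) :=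
    fun i j hij => hdisj i.2 j.2 (fun h => hij (Subtype.ext h))
  refine ⟨ballDensity x' s' w, measurable_ballDensity, fun E U hE hU => ?_, ?_⟩
  · set J : Set u := {i | (closedBall (x' i) (10 * s' i) ∩ E).Nonempty} with hJ
    have hJeq : ∀ y ∈ E, ballDensity x' s' w y = ballDensity (fun i : J => x' i) (fun i : J => s' i)
        (fun i : J => w i) y := by
      intro y hy
      refine (tsum_subtype_eq_of_support_subset (s := J) ?_).symm
      intro i hi
      by_contra hiJ
      refine hi (indicator_of_notMem (fun hyi => hiJ ⟨y, hyi, hy⟩) _)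
    calc ∫⁻ y in E, ballDensity x' s' w y ^ 2 ∂σ
        = ∫⁻ y in E, ballDensity (fun i : J => x' i) (fun i : J => s' i) (fun i : J => w i) y ^ 2 ∂σ :=
          setLIntegral_congr_fun hE.measurableSet fun y hy => by simp only [hJeq y hy]
      _ ≤ ∫⁻ y, ballDensity (fun i : J => x' i) (fun i : J => s' i) (fun i : J => w i) y ^ 2 ∂σ :=
          setLIntegral_le_lintegral _ _
      _ ≤ 2 * (100 * C * (K + 441 * C / c)) * ∑' i : J, ν (closedBall (x' i) (s' i)) := by
          refine lintegral_ballDensity_sq_le hc hct hlow hup (fun i => hs _) (fun i => hs1 _)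
            (fun i j hij => hdisj' (fun h => hij (Subtype.ext h))) (fun i => hsqrt _) fun i => ?_
          refine le_trans (measure_mono (closedBall_subset_closedBall ?_)) (hs3 _)
          exact mul_le_mul_of_nonneg_right hM21 (hs _).le
      _ ≤ 2 * (100 * C * (K + 441 * C / c)) * (μ U + ENNReal.ofReal ε * σ U) := by
          gcongr
          have : Pairwise (Function.onFun Disjoint fun i : J => closedBall (x' i) (s' i)) :=
            fun i j hij => hdisj' (fun h => hij (Subtype.ext h))
          rw [← measure_iUnion this fun i => isClosed_closedBall.measurableSet]
          have hle : ν (⋃ i : J, closedBall (x' i) (s' i)) ≤ ν U := by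
            refine measure_mono (iUnion_subset fun i y hy => hU ?_)
            obtain ⟨i, z, hz, hzE⟩ := i
            rw [mem_thickening_iff]
            refine ⟨z, hzE, ?_⟩
            rw [mem_closedBall] at hy hz
            have h1 := dist_triangle_right y z (x' i)
            have h2 : 21 * s' i < ε := hs2 _
            have h3 : 0 < s' i := hs _
            dsimp only at hy
            linarith
          refine hle.trans_eq ?_
          rw [hν, Measure.add_apply, Measure.smul_apply, smul_eq_mul]
  · intro p m hp hd hm a b hab hdist
    refine edist_le_lintegral_ballDensity (w := w) hp hm hab (fun i => hs _) (fun i => ?_)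
      (hφ.comp_continuous hp hd).continuousOn (fun t _ => ?_) fun i z hz => ?_
    · have h2 : 21 * s' i < ε := hs2 _
      have h3 : 0 < s' i := hs _
      linarith
    · obtain ⟨i, hi, hsub⟩ := hcov ⟨p t, hd t⟩ (mem_univ _)
      exact ⟨⟨i, hi⟩, hsub (mem_closedBall_self (hs _).le)⟩
    · rw [← ENNReal.pow_le_pow_left_iff two_ne_zero, mul_pow, hsqrt, hsqrt, mul_assoc]
      refine (hs4 _ z hz).trans ?_
      gcongr
      exact (hμν _).trans (hs3 _)

end ScaleDensity

section Selection

/-- The distance `|a - b|` in the extended nonnegative reals. -/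
noncomputable def ENNReal.absDiff (a b : ℝ≥0∞) : ℝ≥0∞ := (a - b) ⊔ (b - a)

theorem ENNReal.le_add_absDiff (a b : ℝ≥0∞) : a ≤ b + ENNReal.absDiff a b :=
  tsub_le_iff_left.1 le_sup_left

theorem ENNReal.absDiff_sq_add (a b : ℝ≥0∞) :
    ENNReal.absDiff a b ^ 2 + 4 * ((a + b) / 2) ^ 2 = 2 * a ^ 2 + 2 * b ^ 2 := by
  wlog hab : a ≤ b generalizing a b
  · have := this b a (le_of_not_ge hab)
    rw [add_comm b a, add_comm (2 * b ^ 2)] at this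
    rw [← this, ENNReal.absDiff, ENNReal.absDiff, sup_comm]
  have h4 : ∀ c : ℝ≥0∞, 4 * (c / 2) ^ 2 = c ^ 2 := by
    intro c
    have : (4 : ℝ≥0∞) = 2 ^ 2 := by norm_num
    rw [this, ← mul_pow, ENNReal.mul_div_cancel (by norm_num) (by norm_num)]
  rw [h4, ENNReal.absDiff, tsub_eq_zero_of_le hab, sup_of_le_right (zero_le)]
  rcases eq_or_ne a ⊤ with rfl | ha
  · simp
  obtain ⟨e, rfl⟩ := exists_add_of_le hab
  rw [ENNReal.add_sub_cancel_left ha]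
  ring

theorem ENNReal.tsum_sq_le (a : ℕ → ℝ≥0∞) : (∑' n, a n) ^ 2 ≤ 4 * ∑' n, 4 ^ n * a n ^ 2 := by
  set M : ℝ≥0∞ := (∑' n, 4 ^ n * a n ^ 2) ^ (1 / 2 : ℝ) with hM
  have hM2 : M ^ 2 = ∑' n, 4 ^ n * a n ^ 2 := by
    rw [hM, ← ENNReal.rpow_natCast, ← ENNReal.rpow_mul]; norm_num
  have h1 : ∀ n, a n ≤ 2⁻¹ ^ n * M := by
    intro n
    have h2 : 2 ^ n * a n ≤ M := by
      rw [← ENNReal.pow_le_pow_left_iff two_ne_zero, hM2]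
      refine le_trans (le_of_eq ?_) (ENNReal.le_tsum n)
      rw [mul_pow, ← pow_mul, mul_comm n, pow_mul]; norm_num
    calc a n = 2⁻¹ ^ n * (2 ^ n * a n) := by
          rw [← mul_assoc, ← mul_pow, ENNReal.inv_mul_cancel (by norm_num) (by norm_num)]; simp
      _ ≤ _ := by gcongr
  have h3 : ∑' n, a n ≤ 2 * M := by
    refine (ENNReal.tsum_le_tsum h1).trans_eq ?_
    rw [ENNReal.tsum_mul_right, ENNReal.tsum_geometric, ENNReal.one_sub_inv_two, inv_inv]
  calc (∑' n, a n) ^ 2 ≤ (2 * M) ^ 2 := by gcongr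
    _ = _ := by rw [mul_pow, hM2]; norm_num

variable {X : Type*} [MeasurableSpace X]

theorem measurable_absDiff {u v : X → ℝ≥0∞} (hu : Measurable u) (hv : Measurable v) :
    Measurable fun y => ENNReal.absDiff (u y) (v y) :=
  (hu.sub hv).sup (hv.sub hu)

/-- A decreasing sequence of nonempty, midpoint-convex, bounded sets of densities has a rapidly
Cauchy selection. -/
theorem exists_fast_cauchy_selection {σ : Measure X} {𝒦 : ℕ → Set (X → ℝ≥0∞)} (hanti : Antitone 𝒦)
    (hne : ∀ n, (𝒦 n).Nonempty) (hmeas : ∀ n, ∀ v ∈ 𝒦 n, Measurable v)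
    (hmid : ∀ n, ∀ u ∈ 𝒦 n, ∀ v ∈ 𝒦 n, (fun y => (u y + v y) / 2) ∈ 𝒦 n) {R : ℝ≥0∞} (hR : R ≠ ⊤)
    (hbdd : ∀ n, ∀ v ∈ 𝒦 n, ∫⁻ y, v y ^ 2 ∂σ ≤ R) :
    ∃ v : ℕ → X → ℝ≥0∞, (∀ n, v n ∈ 𝒦 n) ∧
      ∀ n, ∫⁻ y, ENNReal.absDiff (v n y) (v (n + 1) y) ^ 2 ∂σ ≤ 16⁻¹ ^ n := by
  set e : ℕ → ℝ≥0∞ := fun n => ⨅ v ∈ 𝒦 n, ∫⁻ y, v y ^ 2 ∂σ with he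
  have hemono : Monotone e := fun m n hmn => biInf_mono (hanti hmn)
  set E := ⨆ n, e n with hE
  have hER : E ≤ R := iSup_le fun n => by
    obtain ⟨v, hv⟩ := hne n
    exact (iInf₂_le v hv).trans (hbdd n v hv)
  have hEt : E ≠ ⊤ := ne_top_of_le_ne_top hR hER
  set δ : ℕ → ℝ≥0∞ := fun k => 16⁻¹ ^ k / 8 with hδ
  have hδ0 : ∀ k, δ k ≠ 0 := fun k => by
    simp [hδ, ENNReal.div_eq_zero_iff]
  have hδt : ∀ k, δ k ≠ ⊤ := fun k => by
    have : (16⁻¹ : ℝ≥0∞) ^ k ≠ ⊤ := ENNReal.pow_ne_top (by norm_num)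
    simp only [hδ]
    finiteness
  have hδanti : ∀ k, δ (k + 1) ≤ δ k := fun k => by
    simp only [hδ]
    gcongr 1
    exact pow_le_pow_right_of_le_one' (by norm_num) (Nat.le_succ k)
  have hev : ∀ k, ∀ᶠ n in atTop, E ≤ e n + δ k := by
    intro k
    rcases eq_or_ne E 0 with h0 | h0
    · exact Eventually.of_forall fun n => by rw [h0]; exact zero_le
    have hlt : E - δ k < E := ENNReal.sub_lt_self hEt h0 (hδ0 k)
    filter_upwards [(tendsto_atTop_iSup hemono).eventually (lt_mem_nhds hlt)] with n hn
    exact tsub_le_iff_right.1 hn.le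
  obtain ⟨N, hN, hNδ⟩ := extraction_forall_of_eventually hev
  have hexv : ∀ k, ∃ v ∈ 𝒦 (N k), ∫⁻ y, v y ^ 2 ∂σ < E + δ k := by
    intro k
    have hlt : e (N k) < E + δ k := (le_iSup e (N k)).trans_lt (ENNReal.lt_add_right hEt (hδ0 k))
    simpa only [he, iInf_lt_iff, exists_prop] using hlt
  choose v hv hvE using hexv
  refine ⟨v, fun n => hanti (hN.id_le n) (hv n), fun n => ?_⟩
  have hv' : v (n + 1) ∈ 𝒦 (N n) := hanti (hN (Nat.lt_succ_self n)).le (hv (n + 1))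
  have hm1 := hmeas _ _ (hv n)
  have hm2 := hmeas _ _ hv'
  have hkey : ∫⁻ y, ENNReal.absDiff (v n y) (v (n + 1) y) ^ 2 ∂σ +
      4 * ∫⁻ y, ((v n y + v (n + 1) y) / 2) ^ 2 ∂σ =
      2 * ∫⁻ y, v n y ^ 2 ∂σ + 2 * ∫⁻ y, v (n + 1) y ^ 2 ∂σ := by
    rw [← lintegral_const_mul _ (by fun_prop), ← lintegral_const_mul _ (by fun_prop),
      ← lintegral_const_mul _ (by fun_prop),
      ← lintegral_add_left ((measurable_absDiff hm1 hm2).pow_const 2),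
      ← lintegral_add_left (by fun_prop)]
    simp only [ENNReal.absDiff_sq_add]
  have hlowm : e (N n) ≤ ∫⁻ y, ((v n y + v (n + 1) y) / 2) ^ 2 ∂σ := iInf₂_le _ (hmid _ _ (hv n) _ hv')
  have het : e (N n) ≠ ⊤ := ne_top_of_le_ne_top hEt (le_iSup e (N n))
  have hfin : ∫⁻ y, ENNReal.absDiff (v n y) (v (n + 1) y) ^ 2 ∂σ + 4 * e (N n) ≤
      8 * δ n + 4 * e (N n) := by
    calc _ ≤ 2 * ∫⁻ y, v n y ^ 2 ∂σ + 2 * ∫⁻ y, v (n + 1) y ^ 2 ∂σ := by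
          rw [← hkey]; gcongr
      _ ≤ 2 * (e (N n) + δ n + δ n) + 2 * (e (N n) + δ n + δ n) := by
          gcongr
          · exact (hvE n).le.trans (by gcongr; exact hNδ n)
          · exact (hvE (n + 1)).le.trans (add_le_add (hNδ n) (hδanti n))
      _ = _ := by ring
  rw [ENNReal.add_le_add_iff_right (ENNReal.mul_ne_top (by norm_num) het)] at hfin
  refine hfin.trans_eq ?_
  simp only [hδ]
  exact ENNReal.mul_div_cancel (by norm_num) (by norm_num)

theorem le_liminf_add_tail {v : ℕ → ℝ≥0∞} (n : ℕ) :
    v n ≤ liminf v atTop + ∑' k, ENNReal.absDiff (v (k + n)) (v (k + n + 1)) := by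
  have h1 : ∀ k, v n ≤ v (k + n) + ∑ j ∈ Finset.range k, ENNReal.absDiff (v (j + n)) (v (j + n + 1)) := by
    intro k
    induction k with
    | zero => simp
    | succ k ih =>
      rw [Finset.sum_range_succ]
      refine ih.trans ?_
      have h := ENNReal.le_add_absDiff (v (k + n)) (v (k + n + 1))
      rw [show k + 1 + n = k + n + 1 by ring]
      calc _ ≤ (v (k + n + 1) + ENNReal.absDiff (v (k + n)) (v (k + n + 1))) + _ := by gcongr
        _ = _ := by ring
  refine tsub_le_iff_right.1 (le_liminf_of_le (by isBoundedDefault) ?_)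
  filter_upwards [eventually_ge_atTop n] with m hm
  obtain ⟨k, rfl⟩ := Nat.exists_eq_add_of_le' hm
  exact tsub_le_iff_right.2 ((h1 k).trans (by gcongr; exact ENNReal.sum_le_tsum _))

theorem lintegral_tail_sq_ne_top {σ : Measure X} {D : ℕ → X → ℝ≥0∞} (hD : ∀ n, Measurable (D n))
    (hle : ∀ n, ∫⁻ y, D n y ^ 2 ∂σ ≤ 16⁻¹ ^ n) : ∫⁻ y, (∑' n, D n y) ^ 2 ∂σ ≠ ⊤ := by
  have h1 : ∫⁻ y, (∑' n, D n y) ^ 2 ∂σ ≤ 4 * ∑' n : ℕ, (4⁻¹ : ℝ≥0∞) ^ n := by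
    calc _ ≤ ∫⁻ y, 4 * ∑' n, 4 ^ n * D n y ^ 2 ∂σ := lintegral_mono fun y => ENNReal.tsum_sq_le _
      _ = 4 * ∑' n, 4 ^ n * ∫⁻ y, D n y ^ 2 ∂σ := by
          have hm : ∀ n, Measurable fun y => 4 ^ n * D n y ^ 2 := fun n =>
            ((hD n).pow_const 2).const_mul _
          rw [lintegral_const_mul _ (Measurable.tsum hm), lintegral_tsum fun n => (hm n).aemeasurable]
          congr 2
          ext n
          rw [lintegral_const_mul _ ((hD n).pow_const 2)]
      _ ≤ _ := by
          gcongr with n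
          refine (mul_le_mul_right (hle n) _).trans_eq ?_
          rw [← mul_pow]
          congr 1
          have h16 : (16 : ℝ≥0∞) = 4 * 4 := by norm_num
          rw [h16, ENNReal.mul_inv (by norm_num) (by norm_num), ← mul_assoc,
            ENNReal.mul_inv_cancel (by norm_num) (by norm_num), one_mul]
  refine ne_top_of_le_ne_top ?_ h1
  rw [ENNReal.tsum_geometric]
  refine ENNReal.mul_ne_top (by norm_num) (ENNReal.inv_ne_top.2 ?_)
  rw [ne_eq, tsub_eq_zero_iff_le, not_le]
  exact ENNReal.inv_lt_one.2 (by norm_num)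

end Selection

section LimitDensity

variable {X Y : Type*} [MetricSpace X] [CompactSpace X] [MeasurableSpace X] [BorelSpace X]
  [MetricSpace Y]

theorem exists_limit_density {σ μ : Measure X} [IsFiniteMeasure σ] [IsFiniteMeasure μ] {dom : Set X}
    {φ : X → Y} {B L : ℝ≥0∞} (hB : B ≠ ⊤) (hL : L ≠ ⊤)
    (hex : ∀ ε > 0, ∃ v, IsScaleDensity σ μ dom φ B L ε v) :
    ∃ h T : X → ℝ≥0∞, Measurable h ∧ Measurable T ∧ σ.withDensity (fun y => h y ^ 2) ≤ B • μ ∧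
      ∫⁻ y, h y ^ 2 ∂σ ≠ ⊤ ∧ ∫⁻ y, T y ^ 2 ∂σ ≠ ⊤ ∧
      ∀ (p : ℝ → X) (m : Measure ℝ), Continuous p → (∀ t, p t ∈ dom) →
        (∀ c d, c ≤ d → edist (p c) (p d) ≤ m (Icc c d)) → ∫⁻ t, T (p t) ∂m ≠ ⊤ →
        ∀ c d, c ≤ d → edist (φ (p c)) (φ (p d)) ≤ L * ∫⁻ t in Icc c d, h (p t) ∂m := by
  set ε : ℕ → ℝ := fun n => 1 / ((n : ℝ) + 1) with hε
  have hε0 : ∀ n, 0 < ε n := fun n => by positivity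
  have hεlim : Tendsto ε atTop (𝓝 0) := tendsto_one_div_add_atTop_nhds_zero_nat
  have hεanti : Antitone ε := fun m n hmn => by
    simp only [hε]; gcongr
  have hε1 : ∀ n, ε n ≤ 1 := fun n => by simpa [hε] using hεanti (Nat.zero_le n)
  have hfinR : B * (μ univ + σ univ) ≠ ⊤ := by finiteness
  obtain ⟨v, hv, hvd⟩ := exists_fast_cauchy_selection (σ := σ)
    (𝒦 := fun n => {v | IsScaleDensity σ μ dom φ B L (ε n) v})
    (fun m n hmn v hv => hv.mono (hεanti hmn)) (fun n => hex _ (hε0 n)) (fun n v hv => hv.measurable)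
    (fun n u hu v hv => hu.midpoint hv) hfinR (fun n v hv => by
      have := hv.energy_le univ univ isClosed_univ (subset_univ _)
      rw [Measure.restrict_univ] at this
      refine this.trans ?_
      gcongr
      calc ENNReal.ofReal (ε n) * σ univ ≤ 1 * σ univ := by
            gcongr; exact ENNReal.ofReal_le_one.2 (hε1 n)
        _ = _ := one_mul _)
  have hvm : ∀ n, Measurable (v n) := fun n => (hv n).measurable
  set D : ℕ → X → ℝ≥0∞ := fun n y => ENNReal.absDiff (v n y) (v (n + 1) y) with hD
  have hDm : ∀ n, Measurable (D n) := fun n => measurable_absDiff (hvm n) (hvm (n + 1))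
  set h : X → ℝ≥0∞ := fun y => liminf (fun n => v n y) atTop with hh
  have hhm : Measurable h := Measurable.liminf hvm
  set T : X → ℝ≥0∞ := fun y => ∑' n, D n y with hT
  have hTm : Measurable T := Measurable.tsum hDm
  have hclosed : ∀ K U : Set X, IsClosed K → IsOpen U → K ⊆ U → ∫⁻ y in K, h y ^ 2 ∂σ ≤ B * μ U := by
    intro K U hK hU hKU
    obtain ⟨δ, hδ, hδU⟩ := hK.isCompact.exists_thickening_subset_open hU hKU
    have hsq : ∀ y, h y ^ 2 = liminf (fun n => v n y ^ 2) atTop := by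
      intro y
      exact Monotone.map_liminf_of_continuousAt (f := fun a : ℝ≥0∞ => a ^ 2)
        (fun a b hab => by dsimp only; gcongr) (fun n => v n y) (by fun_prop)
    simp only [hsq]
    refine (lintegral_liminf_le fun n => (hvm n).pow_const 2).trans ?_
    have hlim : Tendsto (fun n => B * (μ U + ENNReal.ofReal (ε n) * σ U)) atTop
        (𝓝 (B * (μ U + 0 * σ U))) := by
      refine ENNReal.Tendsto.const_mul (Tendsto.const_add _ (ENNReal.Tendsto.mul_const ?_ ?_))
        (Or.inr hB)
      · simpa using ENNReal.tendsto_ofReal hεlim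
      · exact Or.inr (measure_ne_top _ _)
    rw [zero_mul, add_zero] at hlim
    rw [← hlim.liminf_eq]
    refine liminf_le_liminf ?_
    filter_upwards [hεlim.eventually (gt_mem_nhds hδ)] with n hn
    exact (hv n).energy_le K U hK ((thickening_mono hn.le K).trans hδU)
  have hhfin : ∫⁻ y, h y ^ 2 ∂σ ≠ ⊤ := by
    have := hclosed univ univ isClosed_univ isOpen_univ Subset.rfl
    rw [Measure.restrict_univ] at this
    exact ne_top_of_le_ne_top (by finiteness) this
  refine ⟨h, T, hhm, hTm, ?_, hhfin, lintegral_tail_sq_ne_top hDm hvd, ?_⟩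
  · have hfin : IsFiniteMeasure (σ.withDensity fun y => h y ^ 2) := isFiniteMeasure_withDensity hhfin
    refine Measure.le_iff.2 fun E hE => ?_
    have hfin' : IsFiniteMeasure (B • μ) := μ.smul_finite hB
    rw [hE.measure_eq_iSup_isClosed_of_ne_top (measure_ne_top _ _)]
    refine iSup₂_le fun K hKE => iSup_le fun hK => ?_
    rw [E.measure_eq_iInf_isOpen]
    refine le_iInf₂ fun U hEU => le_iInf fun hU => ?_
    rw [withDensity_apply _ hK.measurableSet, Measure.smul_apply, smul_eq_mul]
    exact hclosed K U hK hU (hKE.trans hEU)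
  · intro p m hp hd hm hTfin c d hcd
    rcases eq_or_ne (p c) (p d) with heq | hne
    · rw [heq, edist_self]; exact zero_le
    have hpm := hp.measurable
    have hDpm : ∀ n, Measurable fun t => D n (p t) := fun n => (hDm n).comp hpm
    have hsum : ∑' k, ∫⁻ t, D k (p t) ∂m ≠ ⊤ := by
      rw [← lintegral_tsum fun n => (hDpm n).aemeasurable]; exact hTfin
    have hlim : Tendsto (fun n => L * (∫⁻ t in Icc c d, h (p t) ∂m + ∑' k, ∫⁻ t, D (k + n) (p t) ∂m))
        atTop (𝓝 (L * (∫⁻ t in Icc c d, h (p t) ∂m + 0))) :=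
      ENNReal.Tendsto.const_mul (Tendsto.const_add _ (ENNReal.tendsto_sum_nat_add _ hsum)) (Or.inr hL)
    rw [add_zero] at hlim
    refine ge_of_tendsto hlim ?_
    filter_upwards [hεlim.eventually (gt_mem_nhds (dist_pos.2 hne))] with n hn
    refine ((hv n).edist_le p m hp hd hm c d hcd hn.le).trans ?_
    gcongr
    calc ∫⁻ t in Icc c d, v n (p t) ∂m
        ≤ ∫⁻ t in Icc c d, (h (p t) + ∑' k, D (k + n) (p t)) ∂m :=
          lintegral_mono fun t => le_liminf_add_tail (v := fun n => v n (p t)) n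
      _ = ∫⁻ t in Icc c d, h (p t) ∂m + ∫⁻ t in Icc c d, ∑' k, D (k + n) (p t) ∂m :=
          lintegral_add_left (hhm.comp hpm) _
      _ ≤ ∫⁻ t in Icc c d, h (p t) ∂m + ∫⁻ t, ∑' k, D (k + n) (p t) ∂m := by
          gcongr; exact Measure.restrict_le_self
      _ = _ := by rw [lintegral_tsum fun k => (hDpm (k + n)).aemeasurable]

end LimitDensity

section CurveTransfer

theorem edist_le_measure_Ioo {Y : Type*} [MetricSpace Y] {q : ℝ → Y} (hq : Continuous q)
    {κ : Measure ℝ} (hκ : ∀ c d, c ≤ d → edist (q c) (q d) ≤ κ (Icc c d)) {c d : ℝ} (hcd : c < d) :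
    edist (q c) (q d) ≤ κ (Ioo c d) := by
  have hlim : Tendsto (fun r : ℝ => edist (q (c + r)) (q (d - r))) (𝓝[>] 0)
      (𝓝 (edist (q (c + 0)) (q (d - 0)))) :=
    Tendsto.mono_left (Continuous.tendsto (by fun_prop) 0) nhdsWithin_le_nhds
  rw [add_zero, sub_zero] at hlim
  refine le_of_tendsto hlim ?_
  have hpos : 0 < (d - c) / 2 := by linarith
  filter_upwards [Ioo_mem_nhdsGT hpos] with r hr
  refine (hκ _ _ (by linarith [hr.2])).trans (measure_mono fun t ht => ?_)
  exact ⟨by linarith [ht.1, hr.1], by linarith [ht.2, hr.1]⟩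

theorem eVariationOn_le_measure {Y : Type*} [MetricSpace Y] {q : ℝ → Y} (hq : Continuous q)
    {κ : Measure ℝ} (hκ : ∀ c d, c ≤ d → edist (q c) (q d) ≤ κ (Icc c d)) (c d : ℝ) :
    eVariationOn q (Icc c d) ≤ κ (Icc c d) := by
  refine iSup_le ?_
  rintro ⟨n, u, hu, hmem⟩
  dsimp only
  calc ∑ i ∈ Finset.range n, edist (q (u (i + 1))) (q (u i))
      ≤ ∑ i ∈ Finset.range n, κ (Ioo (u i) (u (i + 1))) := by
        refine Finset.sum_le_sum fun i _ => ?_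
        rcases (hu (Nat.le_succ i)).eq_or_lt with h | h
        · rw [show u (i + 1) = u i from h.symm, edist_self]; exact zero_le
        · rw [edist_comm]; exact edist_le_measure_Ioo hq hκ h
    _ = κ (⋃ i ∈ Finset.range n, Ioo (u i) (u (i + 1))) := by
        refine (measure_biUnion_finset ?_ fun i _ => measurableSet_Ioo).symm
        exact fun i _ j _ hij => hu.pairwise_disjoint_on_Ioo_succ hij
    _ ≤ κ (Icc c d) := by
        refine measure_mono (iUnion₂_subset fun i _ t ht => ?_)
        exact ⟨(hmem i).1.trans ht.1.le, ht.2.le.trans (hmem (i + 1)).2⟩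

theorem arcIntegralOn_of_lt (ρ : ↥Sphere2 → ℝ≥0∞) (f : ℝ → ↥Sphere2) {a b : ℝ} (hab : b < a) :
    arcIntegralOn ρ f a b = 0 := by
  simp [arcIntegralOn, Icc_eq_empty_of_lt hab]

/-- A density `h` controls `φ` along all curves in `dom` on which `T` is integrable. -/
def ControlsCurves (φ : ↥Sphere2 → ↥Sphere2) (dom : Set ↥Sphere2) (L : ℝ≥0∞)
    (h T : ↥Sphere2 → ℝ≥0∞) : Prop :=
  ∀ (p : ℝ → ↥Sphere2) (m : Measure ℝ), Continuous p → (∀ t, p t ∈ dom) →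
    (∀ c d, c ≤ d → edist (p c) (p d) ≤ m (Icc c d)) → ∫⁻ t, T (p t) ∂m ≠ ⊤ →
    ∀ c d, c ≤ d → edist (φ (p c)) (φ (p d)) ≤ L * ∫⁻ t in Icc c d, h (p t) ∂m

theorem ControlsCurves.arcIntegralOn_le {φ : ↥Sphere2 → ↥Sphere2} {dom : Set ↥Sphere2} {L : ℝ≥0∞}
    {h T : ↥Sphere2 → ℝ≥0∞} (hctl : ControlsCurves φ dom L h T) (hL : L ≠ ⊤)
    (hφ : ContinuousOn φ dom) (hh : Measurable h)
    (hT : Measurable T) {γ γ' : ℝ → ↥Sphere2} {a b : ℝ} (hab : a ≤ b)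
    (hγ : ContinuousOn γ (Icc a b)) (hv : eVariationOn γ (Icc a b) ≠ ⊤)
    (hdom : ∀ t ∈ Icc a b, γ t ∈ dom) (hγ' : ∀ t ∈ Icc a b, γ' t = φ (γ t))
    (hfin : arcIntegralOn (fun y => h y + T y) γ a b ≠ ⊤) :
    eVariationOn γ' (Icc a b) ≠ ⊤ ∧ ∀ ρ ρ' : ↥Sphere2 → ℝ≥0∞, Measurable ρ → Measurable ρ' →
      (∀ y ∈ dom, L * h y * ρ' (φ y) ≤ ρ y) → arcIntegralOn ρ' γ' a b ≤ arcIntegralOn ρ γ a b := by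
  set p := clampCurve γ hab with hp
  set m := arcMeasure γ a b with hm
  have hpc : Continuous p := continuous_clampCurve hab hγ
  have hpm := hpc.measurable
  have hpd : ∀ t, p t ∈ dom := fun t => hdom _ (projIcc a b hab t).2
  have hhp : Measurable fun t => h (p t) := hh.comp hpm
  have hhT : Measurable fun y => h y + T y := hh.add hT
  rw [arcIntegralOn_eq_lintegral hab hv hγ hhT, lintegral_add_left hhp] at hfin
  obtain ⟨hfh, hfT⟩ := ENNReal.add_ne_top.1 hfin
  set κ : Measure ℝ := m.withDensity fun t => L * h (p t) with hκ
  have hκfin : IsFiniteMeasure κ := by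
    refine isFiniteMeasure_withDensity ?_
    rw [lintegral_const_mul _ hhp]
    exact ENNReal.mul_ne_top hL hfh
  have hγ'c : ContinuousOn γ' (Icc a b) := (hφ.comp hγ hdom).congr hγ'
  set q := clampCurve γ' hab with hq
  have hqc : Continuous q := continuous_clampCurve hab hγ'c
  have hqp : ∀ t, q t = φ (p t) := fun t => hγ' _ (projIcc a b hab t).2
  have hqκ : ∀ c d, c ≤ d → edist (q c) (q d) ≤ κ (Icc c d) := by
    intro c d hcd
    rw [hκ, withDensity_apply _ measurableSet_Icc, lintegral_const_mul _ hhp, hqp, hqp]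
    exact hctl p m hpc hpd (fun c d hcd => edist_le_arcMeasure hab hv hcd) hfT c d hcd
  have hvar := eVariationOn_le_measure hqc hqκ
  have hv' : eVariationOn γ' (Icc a b) ≠ ⊤ := by
    have : eVariationOn γ' (Icc a b) = eVariationOn q (Icc a b) :=
      eVariationOn.eq_of_eqOn fun t ht => by rw [hq, clampCurve, projIcc_of_mem hab ht]
    rw [this]
    exact ne_top_of_le_ne_top (measure_ne_top κ _) (hvar a b)
  refine ⟨hv', fun ρ ρ' hρ hρ' hle => ?_⟩
  have hmle : arcMeasure γ' a b ≤ κ := measure_le_of_Ioo_le_Icc _ _ fun c d _ =>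
    (arcMeasure_Ioo_le hab hv' c d).trans (hvar c d)
  rw [arcIntegralOn_eq_lintegral hab hv' hγ'c hρ', arcIntegralOn_eq_lintegral hab hv hγ hρ]
  calc ∫⁻ t, ρ' (q t) ∂arcMeasure γ' a b ≤ ∫⁻ t, ρ' (q t) ∂κ := lintegral_mono' hmle le_rfl
    _ = ∫⁻ t, (L * h (p t)) * ρ' (q t) ∂m := by
        have h1 : Measurable fun t => L * h (p t) := hhp.const_mul L
        have h2 : Measurable fun t => ρ' (q t) := hρ'.comp hqc.measurable
        rw [hκ, lintegral_withDensity_eq_lintegral_mul _ h1 h2]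
        rfl
    _ ≤ ∫⁻ t, ρ (p t) ∂m := lintegral_mono fun t => by rw [hqp]; exact hle _ (hpd t)

theorem SpherePath.lineIntegral_mono {ρ ρ' : ↥Sphere2 → ℝ≥0∞} (h : ∀ y, ρ y ≤ ρ' y) (γ : SpherePath) :
    γ.lineIntegral ρ ≤ γ.lineIntegral ρ' :=
  iSup_mono fun _ => iSup_mono fun _ => iSup_mono fun _ => lintegral_mono fun _ => h _

theorem SpherePath.mul_lineIntegral_le (k : ℝ≥0∞) (ρ : ↥Sphere2 → ℝ≥0∞) (γ : SpherePath) :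
    k * γ.lineIntegral ρ ≤ γ.lineIntegral fun y => k * ρ y := by
  simp only [SpherePath.lineIntegral, ENNReal.mul_iSup]
  exact iSup_mono fun _ => iSup_mono fun _ => iSup_mono fun _ => lintegral_const_mul_le _ _

theorem SpherePath.arcIntegralOn_le_lineIntegral (γ : SpherePath) (ρ : ↥Sphere2 → ℝ≥0∞) {a b : ℝ}
    (hab : Icc a b ⊆ γ.I) : arcIntegralOn ρ γ.toFun a b ≤ γ.lineIntegral ρ :=
  le_iSup_of_le a (le_iSup_of_le b (le_iSup_of_le hab le_rfl))

theorem ControlsCurves.lineIntegral_le {φ : ↥Sphere2 → ↥Sphere2} {dom : Set ↥Sphere2} {L : ℝ≥0∞}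
    {h T : ↥Sphere2 → ℝ≥0∞} (hctl : ControlsCurves φ dom L h T) (hL : L ≠ ⊤)
    (hφ : ContinuousOn φ dom) (hh : Measurable h) (hT : Measurable T) {γ γ' : SpherePath}
    (hrect : γ.LocRectifiable) (hdom : γ.image ⊆ dom) (hI : γ'.I = γ.I)
    (hγ' : ∀ t ∈ γ.I, γ'.toFun t = φ (γ.toFun t))
    (hfin : γ.lineIntegral (fun y => h y + T y) ≠ ⊤) :
    γ'.LocRectifiable ∧ ∀ ρ ρ' : ↥Sphere2 → ℝ≥0∞, Measurable ρ → Measurable ρ' →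
      (∀ y ∈ dom, L * h y * ρ' (φ y) ≤ ρ y) → γ'.lineIntegral ρ' ≤ γ.lineIntegral ρ := by
  have key : ∀ a b, a ≤ b → Icc a b ⊆ γ.I → _ := fun a b hab hsub =>
    hctl.arcIntegralOn_le hL hφ hh hT hab (γ.cont.mono hsub) (hrect a b hsub).ne
      (fun t ht => hdom ⟨t, hsub ht, rfl⟩) (fun t ht => hγ' t (hsub ht))
      (ne_top_of_le_ne_top hfin (γ.arcIntegralOn_le_lineIntegral _ hsub))
  refine ⟨fun a b hsub => ?_, fun ρ ρ' hρ hρ' hle => ?_⟩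
  · rw [hI] at hsub
    rcases le_or_gt a b with hab | hab
    · exact (key a b hab hsub).1.lt_top
    · simp [Icc_eq_empty_of_lt hab]
  · refine iSup_le fun a => iSup_le fun b => iSup_le fun hsub => ?_
    rw [hI] at hsub
    rcases le_or_gt a b with hab | hab
    · exact ((key a b hab hsub).2 ρ ρ' hρ hρ' hle).trans (γ.arcIntegralOn_le_lineIntegral _ hsub)
    · rw [arcIntegralOn_of_lt _ _ hab]; exact zero_le

end CurveTransfer

section NullFamilies

theorem exists_admissible_lt {Γ : Set SpherePath} (hΓ : conformalModulus Γ = 0) {δ : ℝ≥0∞}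
    (hδ : δ ≠ 0) : ∃ ρ : ↥Sphere2 → ℝ≥0∞, Measurable ρ ∧
      (∀ γ ∈ Γ, γ.LocRectifiable → 1 ≤ γ.lineIntegral ρ) ∧ ∫⁻ x, ρ x ^ 2 ∂sphereMeasure < δ := by
  have h : conformalModulus Γ < δ := by rw [hΓ]; exact pos_iff_ne_zero.2 hδ
  simpa only [conformalModulus, iInf_lt_iff, exists_prop] using h

theorem conformalModulus_eq_zero_of_controlsCurves {φ ψ : ↥Sphere2 → ↥Sphere2}
    {dom D' : Set ↥Sphere2} (hopen : IsOpen dom) (hφ : ContinuousOn φ dom) (hD' : IsOpen D')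
    (hψ : ContinuousOn ψ D') (hφψ : ∀ y ∈ D', φ (ψ y) = y) {h T : ↥Sphere2 → ℝ≥0∞} {B L : ℝ≥0∞}
    (hB : B ≠ ⊤) (hL : L ≠ ⊤) (hh : Measurable h) (hT : Measurable T)
    (hle : sphereMeasure.withDensity (fun y => h y ^ 2) ≤
      B • (sphereMeasure.restrict D').map ψ)
    (hhfin : ∫⁻ y, h y ^ 2 ∂sphereMeasure ≠ ⊤) (hTfin : ∫⁻ y, T y ^ 2 ∂sphereMeasure ≠ ⊤)
    (hctl : ControlsCurves φ dom L h T) {Γ Γ' : Set SpherePath} (hΓ : ∀ γ ∈ Γ, γ.image ⊆ dom)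
    (hΓ' : conformalModulus Γ' = 0)
    (hrel : ∀ γ ∈ Γ, ∃ γ' ∈ Γ', γ'.I = γ.I ∧ ∀ t ∈ γ.I, γ'.toFun t = φ (γ.toFun t)) :
    conformalModulus Γ = 0 := by
  classical
  rcases dom.eq_empty_or_nonempty with rfl | ⟨x₀, hx₀⟩
  · have hempty : ∀ γ ∈ Γ, False := by
      intro γ hγ
      obtain ⟨a, b, hab, hI⟩ := γ.hI
      have hmem : (a + b) / 2 ∈ γ.I := by
        rcases hI with h | h | h | h <;> rw [h] <;> constructor <;> linarith
      exact hΓ γ hγ ⟨_, hmem, rfl⟩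
    refine nonpos_iff_eq_zero.1 ?_
    refine (iInf₂_le (fun _ => 0) measurable_const).trans ((iInf_le _ ?_).trans (by simp))
    exact fun γ hγ => (hempty γ hγ).elim
  set M : ℝ≥0∞ := ∫⁻ y, (h y + T y) ^ 2 ∂sphereMeasure with hM
  have hadd : ∀ a b : ℝ≥0∞, (a + b) ^ 2 ≤ 2 * a ^ 2 + 2 * b ^ 2 := fun a b => by
    have h4 : 4 * ((a + b) / 2) ^ 2 = (a + b) ^ 2 := by
      rw [show (4 : ℝ≥0∞) = 2 ^ 2 by norm_num, ← mul_pow,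
        ENNReal.mul_div_cancel (by norm_num) (by norm_num)]
    rw [← ENNReal.absDiff_sq_add a b, h4]
    exact le_add_self
  have hMfin : M ≠ ⊤ := by
    have h1 : M ≤ 2 * ∫⁻ y, h y ^ 2 ∂sphereMeasure + 2 * ∫⁻ y, T y ^ 2 ∂sphereMeasure := by
      rw [← lintegral_const_mul _ (hh.pow_const 2), ← lintegral_const_mul _ (hT.pow_const 2),
        ← lintegral_add_left ((hh.pow_const 2).const_mul 2)]
      exact lintegral_mono fun y => hadd _ _
    exact ne_top_of_le_ne_top (by finiteness) h1
  set φ' : ↥Sphere2 → ↥Sphere2 := dom.piecewise φ fun _ => x₀ with hφ'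
  have hφ'm : Measurable φ' := hφ.measurable_piecewise continuousOn_const hopen.measurableSet
  have hbound : ∀ n : ℕ, conformalModulus Γ ≤
      2 * (L ^ 2 * (B * (n : ℝ≥0∞)⁻¹)) + 2 * (((n : ℝ≥0∞)⁻¹) ^ 2 * M) := by
    intro n
    set η : ℝ≥0∞ := (n : ℝ≥0∞)⁻¹ with hη
    have hη0 : η ≠ 0 := ENNReal.inv_ne_zero.2 (ENNReal.natCast_ne_top n)
    obtain ⟨ρ', hρ', hadm, hlt⟩ := exists_admissible_lt hΓ' hη0
    set G : ↥Sphere2 → ℝ≥0∞ := dom.indicator fun y => ρ' (φ' y) with hG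
    have hGm : Measurable G := (hρ'.comp hφ'm).indicator hopen.measurableSet
    have hGeq : ∀ y ∈ dom, G y = ρ' (φ y) := fun y hy => by
      rw [hG, indicator_of_mem hy, hφ', piecewise_eq_of_mem _ _ _ hy]
    have hGle : ∀ y ∈ D', G (ψ y) ≤ ρ' y := fun y hy => by
      by_cases hd : ψ y ∈ dom
      · rw [hGeq _ hd, hφψ y hy]
      · rw [hG, indicator_of_notMem hd]; exact zero_le
    have h1m : Measurable fun y => L * h y * G y := (hh.const_mul L).mul hGm
    have h2m : Measurable fun y => η * (h y + T y) := (hh.add hT).const_mul η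
    set ρ : ↥Sphere2 → ℝ≥0∞ := fun y => L * h y * G y + η * (h y + T y) with hρ
    have hρm : Measurable ρ := h1m.add h2m
    have hρadm : ∀ γ ∈ Γ, γ.LocRectifiable → 1 ≤ γ.lineIntegral ρ := by
      intro γ hγ hrect
      by_cases hfin : γ.lineIntegral (fun y => h y + T y) = ⊤
      · have h1 : η * γ.lineIntegral (fun y => h y + T y) ≤ γ.lineIntegral ρ :=
          (γ.mul_lineIntegral_le _ _).trans (SpherePath.lineIntegral_mono (fun y => le_add_self) γ)
        rw [hfin, ENNReal.mul_top hη0] at h1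
        exact le_top.trans h1
      · obtain ⟨γ', hγ', hI, hval⟩ := hrel γ hγ
        obtain ⟨hr, hcmp⟩ := hctl.lineIntegral_le hL hφ hh hT hrect (hΓ γ hγ) hI hval hfin
        refine (hadm γ' hγ' hr).trans (hcmp ρ ρ' hρm hρ' fun y hy => ?_)
        rw [← hGeq y hy]
        exact le_self_add
    refine (iInf₂_le ρ hρm).trans ((iInf_le _ hρadm).trans ?_)
    calc ∫⁻ y, ρ y ^ 2 ∂sphereMeasure
        ≤ ∫⁻ y, (2 * (L * h y * G y) ^ 2 + 2 * (η * (h y + T y)) ^ 2) ∂sphereMeasure :=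
          lintegral_mono fun y => hadd _ _
      _ = 2 * ∫⁻ y, (L * h y * G y) ^ 2 ∂sphereMeasure +
          2 * ∫⁻ y, (η * (h y + T y)) ^ 2 ∂sphereMeasure := by
          rw [lintegral_add_left ((h1m.pow_const 2).const_mul 2),
            lintegral_const_mul _ (h1m.pow_const 2), lintegral_const_mul _ (h2m.pow_const 2)]
      _ ≤ _ := by
          gcongr
          · have h3 : ∀ y, (L * h y * G y) ^ 2 = L ^ 2 * (h y ^ 2 * G y ^ 2) := fun y => by ring
            simp only [h3]
            have h4 : Measurable fun y => h y ^ 2 * G y ^ 2 :=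
              (hh.pow_const 2).mul (hGm.pow_const 2)
            rw [lintegral_const_mul _ h4]
            gcongr
            calc ∫⁻ y, h y ^ 2 * G y ^ 2 ∂sphereMeasure
                = ∫⁻ y, G y ^ 2 ∂sphereMeasure.withDensity (fun y => h y ^ 2) := by
                  rw [lintegral_withDensity_eq_lintegral_mul _ (hh.pow_const 2) (hGm.pow_const 2)]
                  rfl
              _ ≤ ∫⁻ y, G y ^ 2 ∂(B • (sphereMeasure.restrict D').map ψ) :=
                  lintegral_mono' hle le_rfl
              _ = B * ∫⁻ y in D', G (ψ y) ^ 2 ∂sphereMeasure := by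
                  rw [lintegral_smul_measure, lintegral_map' (hGm.pow_const 2).aemeasurable
                    (hψ.aemeasurable hD'.measurableSet), smul_eq_mul]
              _ ≤ B * ∫⁻ y in D', ρ' y ^ 2 ∂sphereMeasure := by
                  gcongr B * ?_
                  refine setLIntegral_mono (hρ'.pow_const 2) fun y hy => ?_
                  gcongr
                  exact hGle y hy
              _ ≤ B * η := by
                  gcongr
                  exact (setLIntegral_le_lintegral _ _).trans hlt.le
          · simp only [mul_pow]
            have h5 : Measurable fun y => (h y + T y) ^ 2 := (hh.add hT).pow_const 2
            rw [lintegral_const_mul _ h5]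
  have hlim : Tendsto (fun n : ℕ => 2 * (L ^ 2 * (B * (n : ℝ≥0∞)⁻¹)) + 2 * (((n : ℝ≥0∞)⁻¹) ^ 2 * M))
      atTop (𝓝 (2 * (L ^ 2 * (B * 0)) + 2 * (0 ^ 2 * M))) := by
    have h0 := ENNReal.tendsto_inv_nat_nhds_zero
    refine Tendsto.add ?_ ?_
    · refine ENNReal.Tendsto.const_mul (ENNReal.Tendsto.const_mul
        (ENNReal.Tendsto.const_mul h0 (Or.inr hB)) (Or.inr (by finiteness))) (Or.inr (by norm_num))
    · exact ENNReal.Tendsto.const_mul (ENNReal.Tendsto.mul_const (((ENNReal.continuous_pow 2).tendsto 0).comp h0)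
        (Or.inr hMfin)) (Or.inr (by norm_num))
  simp only [mul_zero, ne_eq, OfNat.ofNat_ne_zero, not_false_eq_true, zero_pow, zero_mul,
    add_zero] at hlim
  exact nonpos_iff_eq_zero.1 (ge_of_tendsto' hlim hbound)

end NullFamilies

section Distortion

/-- `f` distorts small balls centred at points of `D` by a factor at most `K`. -/
def HasBoundedDistortionOn (f : ↥Sphere2 → ↥Sphere2) (D : Set ↥Sphere2) (K : ℝ) : Prop :=
  ∀ x ∈ D, ∃ r₀ > 0, ∀ r, 0 < r → r < r₀ → ∀ y ∈ D, ∀ z ∈ D, dist x y ≤ r → r ≤ dist x z →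
    dist (f x) (f y) ≤ K * dist (f x) (f z)

theorem hasBoundedDistortionOn_of_limsup_le {f : ↥Sphere2 → ↥Sphere2} {D : Set ↥Sphere2}
    {H : ℝ≥0∞} (hH : H < ⊤)
    (hlim : ∀ x ∈ D, limsup (qcRatioOn f D x) (𝓝[>] (0 : ℝ)) ≤ H) :
    HasBoundedDistortionOn f D (H.toReal + 1) := by
  intro x hx
  have hlt : limsup (qcRatioOn f D x) (𝓝[>] (0 : ℝ)) < H + 1 :=
    (hlim x hx).trans_lt (ENNReal.lt_add_right hH.ne one_ne_zero)
  have hev := eventually_lt_of_limsup_lt hlt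
  rw [eventually_nhdsWithin_iff, Metric.eventually_nhds_iff] at hev
  obtain ⟨r₀, hr₀, hev⟩ := hev
  refine ⟨r₀, hr₀, fun r hr hrr y hy z hz hxy hxz => ?_⟩
  have hratio := (hev (by rwa [Real.dist_eq, sub_zero, abs_of_pos hr]) hr).le
  rw [qcRatioOn, ENNReal.div_le_iff_le_mul (Or.inr (by finiteness)) (Or.inr (by simp))] at hratio
  have hchain : ENNReal.ofReal (dist (f x) (f y)) ≤
      (H + 1) * ENNReal.ofReal (dist (f x) (f z)) :=
    (le_iSup₂ (f := fun y (_ : y ∈ {y | y ∈ D ∧ dist x y ≤ r}) =>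
      ENNReal.ofReal (dist (f x) (f y))) y ⟨hy, hxy⟩).trans (hratio.trans (by
        gcongr
        exact iInf₂_le (f := fun y (_ : y ∈ {y | y ∈ D ∧ r ≤ dist x y}) =>
          ENNReal.ofReal (dist (f x) (f y))) z ⟨hz, hxz⟩))
  have hHK : H + 1 = ENNReal.ofReal (H.toReal + 1) := by
    rw [ENNReal.ofReal_add ENNReal.toReal_nonneg zero_le_one, ENNReal.ofReal_toReal hH.ne,
      ENNReal.ofReal_one]
  rw [hHK, ← ENNReal.ofReal_mul (by positivity)] at hchain
  exact (ENNReal.ofReal_le_ofReal_iff (by positivity)).1 hchain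

variable {f g : ↥Sphere2 → ↥Sphere2} {D D' : Set ↥Sphere2} {K : ℝ} {c : ℝ≥0∞}

theorem HasBoundedDistortionOn.edist_sq_le (hf : HasBoundedDistortionOn f D K) (hK : 1 ≤ K)
    (hD : IsOpen D) (hD' : IsOpen D') (hfc : ContinuousOn f D) (hgc : ContinuousOn g D')
    (hmaps : MapsTo f D D') (hmaps' : MapsTo g D' D) (hfg : LeftInvOn f g D')
    (hc : c ≠ 0) (hct : c ≠ ⊤)
    (hlow : ∀ (y : ↥Sphere2) (r : ℝ), 0 < r → r ≤ 1 / 2 →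
      c * ENNReal.ofReal r ^ 2 ≤ sphereMeasure (ball y r)) :
    ∀ x ∈ D, ∃ s₀ > 0, ∀ s, 0 < s → s < s₀ → ∀ z ∈ closedBall x s,
      edist (f x) (f z) ^ 2 ≤ (ENNReal.ofReal K ^ 2 * c⁻¹) *
        (sphereMeasure.restrict D').map g (closedBall x (1 * s)) := by
  intro x hx
  obtain ⟨r₀, hr₀, hW⟩ := hf x hx
  obtain ⟨ε, hε, hεD⟩ := Metric.isOpen_iff.1 hD' (f x) (hmaps hx)
  have hnear : ∀ᶠ z in 𝓝 x, z ∈ D ∧ f z ∈ ball (f x) (min ε (1 / 2)) :=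
    (hD.eventually_mem hx).and ((hfc.continuousAt (hD.mem_nhds hx)).eventually
      (ball_mem_nhds _ (by positivity)))
  obtain ⟨δ, hδ, hball⟩ := Metric.eventually_nhds_iff.1 hnear
  refine ⟨min r₀ δ, by positivity, fun s hs hss z hz => ?_⟩
  rw [mem_closedBall] at hz
  obtain ⟨hzD, hfz⟩ := hball (hz.trans_lt (hss.trans_le (min_le_right _ _)))
  rw [mem_ball', lt_min_iff] at hfz
  rcases eq_or_ne (f x) (f z) with heq | hne
  · simp [heq]
  have ht : 0 < dist (f x) (f z) := dist_pos.2 hne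
  have hK0 : 0 < K := by linarith
  have hle : dist (f x) (f z) / K ≤ dist (f x) (f z) := div_le_self ht.le hK
  have hsub : ball (f x) (dist (f x) (f z) / K) ⊆ g ⁻¹' closedBall x (1 * s) ∩ D' := by
    intro w hw
    have hwD : w ∈ D' := hεD (ball_subset_ball (hle.trans hfz.1.le) hw)
    refine ⟨?_, hwD⟩
    rw [mem_preimage, mem_closedBall', one_mul]
    by_contra! hlt
    have hdist := hW s hs (hss.trans_le (min_le_left _ _)) z hzD (g w) (hmaps' hwD)
      (by rwa [dist_comm]) hlt.le
    rw [hfg hwD] at hdist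
    rw [mem_ball', lt_div_iff₀ hK0] at hw
    linarith
  have hmeas : c * ENNReal.ofReal (dist (f x) (f z) / K) ^ 2 ≤
      (sphereMeasure.restrict D').map g (closedBall x (1 * s)) := by
    rw [Measure.map_apply_of_aemeasurable (hgc.aemeasurable hD'.measurableSet)
      isClosed_closedBall.measurableSet, Measure.restrict_apply' hD'.measurableSet]
    exact (hlow _ _ (by positivity) (hle.trans hfz.2.le)).trans (measure_mono hsub)
  calc edist (f x) (f z) ^ 2
      = ENNReal.ofReal (K * (dist (f x) (f z) / K)) ^ 2 := by
        rw [edist_dist, mul_div_cancel₀ _ hK0.ne']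
    _ = (ENNReal.ofReal K ^ 2 * c⁻¹) * (c * ENNReal.ofReal (dist (f x) (f z) / K) ^ 2) := by
        rw [ENNReal.ofReal_mul hK0.le, mul_pow, mul_assoc, ← mul_assoc c⁻¹,
          ENNReal.inv_mul_cancel hc hct, one_mul]
    _ ≤ _ := by gcongr

theorem HasBoundedDistortionOn.edist_inverse_sq_le (hf : HasBoundedDistortionOn f D K)
    (hK : 1 ≤ K) (hD : IsOpen D) (hD' : IsOpen D') (hfc : ContinuousOn f D)
    (hgc : ContinuousOn g D') (hmaps' : MapsTo g D' D) (hfg : LeftInvOn f g D')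
    (hc : c ≠ 0) (hct : c ≠ ⊤)
    (hlow : ∀ (y : ↥Sphere2) (r : ℝ), 0 < r → r ≤ 1 / 2 →
      c * ENNReal.ofReal r ^ 2 ≤ sphereMeasure (ball y r)) :
    ∀ y ∈ D', ∃ s₀ > 0, ∀ s, 0 < s → s < s₀ → ∀ w ∈ closedBall y s,
      edist (g y) (g w) ^ 2 ≤ c⁻¹ *
        (sphereMeasure.restrict D).map f (closedBall y (K * s)) := by
  intro y hy
  obtain ⟨r₀, hr₀, hW⟩ := hf (g y) (hmaps' hy)
  obtain ⟨ε, hε, hεD⟩ := Metric.isOpen_iff.1 hD (g y) (hmaps' hy)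
  have hnear : ∀ᶠ w in 𝓝 y, w ∈ D' ∧ g w ∈ ball (g y) (min (min ε r₀) (1 / 2)) :=
    (hD'.eventually_mem hy).and ((hgc.continuousAt (hD'.mem_nhds hy)).eventually
      (ball_mem_nhds _ (by positivity)))
  obtain ⟨δ, hδ, hball⟩ := Metric.eventually_nhds_iff.1 hnear
  refine ⟨δ, hδ, fun s hs hss w hw => ?_⟩
  rw [mem_closedBall] at hw
  obtain ⟨hwD, hgw⟩ := hball (hw.trans_lt hss)
  rw [mem_ball', lt_min_iff, lt_min_iff] at hgw
  rcases eq_or_ne (g y) (g w) with heq | hne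
  · simp [heq]
  have ht : 0 < dist (g y) (g w) := dist_pos.2 hne
  have hsub : ball (g y) (dist (g y) (g w)) ⊆ f ⁻¹' closedBall y (K * s) ∩ D := by
    intro u hu
    have huD : u ∈ D := hεD (ball_subset_ball hgw.1.1.le hu)
    refine ⟨?_, huD⟩
    have hdist := hW _ ht hgw.1.2 u huD (g w) (hmaps' hwD) (mem_ball'.1 hu).le le_rfl
    rw [hfg hy, hfg hwD, dist_comm y w] at hdist
    rw [mem_preimage, mem_closedBall']
    exact hdist.trans (by gcongr)
  have hmeas : c * ENNReal.ofReal (dist (g y) (g w)) ^ 2 ≤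
      (sphereMeasure.restrict D).map f (closedBall y (K * s)) := by
    rw [Measure.map_apply_of_aemeasurable (hfc.aemeasurable hD.measurableSet)
      isClosed_closedBall.measurableSet, Measure.restrict_apply' hD.measurableSet]
    exact (hlow _ _ ht hgw.2.le).trans (measure_mono hsub)
  calc edist (g y) (g w) ^ 2
      = c⁻¹ * (c * ENNReal.ofReal (dist (g y) (g w)) ^ 2) := by
        rw [edist_dist, ← mul_assoc, ENNReal.inv_mul_cancel hc hct, one_mul]
    _ ≤ _ := by gcongr

/-- A continuous map whose small-scale oscillation is controlled by a finite measure pushed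
forward from its inverse pulls back families of modulus zero to families of modulus zero. -/
theorem conformalModulus_eq_zero_of_edist_sq_le {φ ψ : ↥Sphere2 → ↥Sphere2}
    {dom D' : Set ↥Sphere2} (hopen : IsOpen dom) (hφ : ContinuousOn φ dom) (hD' : IsOpen D')
    (hψ : ContinuousOn ψ D') (hφψ : LeftInvOn φ ψ D') {Q : ℝ≥0∞} (hQt : Q ≠ ⊤) {A : ℝ}
    (hQ : ∀ x ∈ dom, ∃ s₀ > 0, ∀ s, 0 < s → s < s₀ → ∀ z ∈ closedBall x s,
      edist (φ x) (φ z) ^ 2 ≤ Q * (sphereMeasure.restrict D').map ψ (closedBall x (A * s)))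
    {Γ Γ' : Set SpherePath} (hΓ : ∀ γ ∈ Γ, γ.image ⊆ dom) (hΓ' : conformalModulus Γ' = 0)
    (hrel : ∀ γ ∈ Γ, ∃ γ' ∈ Γ', γ'.I = γ.I ∧ ∀ t ∈ γ.I, γ'.toFun t = φ (γ.toFun t)) :
    conformalModulus Γ = 0 := by
  obtain ⟨c, C, hc, hct, hC, hreg⟩ := sphereMeasure_regular
  obtain ⟨B, L, hB, hL, hex⟩ := exists_isScaleDensity hc hct hC
    (fun y r hr hr' => (hreg y r hr hr').1.trans (measure_mono ball_subset_closedBall))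
    (fun y r hr hr' => (hreg y r hr hr').2) hφ hQt hQ
  obtain ⟨h, T, hh, hT, hle, hhfin, hTfin, hctl⟩ := exists_limit_density hB hL hex
  exact conformalModulus_eq_zero_of_controlsCurves hopen hφ hD' hψ hφψ hB hL hh hT hle hhfin
    hTfin hctl hΓ hΓ' hrel

end Distortion

section CarpetCombinatorics

theorem IsPeripheralCircle.image {φ ψ : ↥Sphere2 → ↥Sphere2} {D D' S C : Set ↥Sphere2}
    (hφ : ContinuousOn φ D) (hψ : ContinuousOn ψ D') (hmaps : MapsTo φ D D')
    (hψφ : LeftInvOn ψ φ D) (hSD : S ⊆ D) (hC : IsPeripheralCircle S C) :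
    IsPeripheralCircle (φ '' S) (φ '' C) := by
  obtain ⟨hCS, ⟨e⟩, hconn⟩ := hC
  have hCD : C ⊆ D := hCS.trans hSD
  refine ⟨image_mono hCS, ⟨?_⟩, ?_⟩
  · refine Homeomorph.trans ?_ e
    refine
      { toFun := fun y => ⟨ψ y, ?_⟩
        invFun := fun x => ⟨φ x, mem_image_of_mem φ x.2⟩
        left_inv := ?_
        right_inv := ?_
        continuous_toFun := ?_
        continuous_invFun := ?_ }
    · obtain ⟨x, hx, hxy⟩ := y.2
      rw [← hxy, hψφ (hCD hx)]
      exact hx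
    · rintro ⟨_, x, hx, rfl⟩
      exact Subtype.ext (congrArg φ (hψφ (hCD hx)))
    · rintro ⟨x, hx⟩
      exact Subtype.ext (hψφ (hCD hx))
    · refine Continuous.subtype_mk ?_ _
      exact continuousOn_iff_continuous_domRestrict.1
        (hψ.mono ((image_mono hCD).trans hmaps.image_subset))
    · refine Continuous.subtype_mk ?_ _
      exact continuousOn_iff_continuous_domRestrict.1 (hφ.mono hCD)
  · rw [← (hψφ.injOn.mono hSD).image_sdiff_subset hCS]
    exact hconn.image φ (hφ.mono (sdiff_subset.trans hSD))

theorem carpetModulus_le_of_null_transfer {φ ψ : ↥Sphere2 → ↥Sphere2} {D D' S : Set ↥Sphere2}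
    (hφ : ContinuousOn φ D) (hψ : ContinuousOn ψ D') (hmaps : MapsTo φ D D')
    (hψφ : LeftInvOn ψ φ D) (hmaps' : MapsTo ψ D' D) (hφψ : LeftInvOn φ ψ D') (hSD : S ⊆ D)
    {Γ Γ' : Set SpherePath} (hΓ : ∀ γ ∈ Γ, γ.image ⊆ D)
    (hrel : ∀ γ ∈ Γ, ∃ γ' ∈ Γ', γ'.I = γ.I ∧ ∀ t ∈ γ.I, γ'.toFun t = φ (γ.toFun t))
    (hnull : ∀ Γ₀ Γ₀' : Set SpherePath, (∀ γ ∈ Γ₀, γ.image ⊆ D) → conformalModulus Γ₀' = 0 →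
      (∀ γ ∈ Γ₀, ∃ γ' ∈ Γ₀', γ'.I = γ.I ∧ ∀ t ∈ γ.I, γ'.toFun t = φ (γ.toFun t)) →
      conformalModulus Γ₀ = 0) :
    carpetModulus S Γ ≤ carpetModulus (φ '' S) Γ' := by
  have hS' : φ '' S ⊆ D' := (image_mono hSD).trans hmaps.image_subset
  have hback : ∀ A ⊆ D, ψ '' (φ '' A) = A := fun A hA => hψφ.image_image' hA
  have hforth : ∀ A ⊆ D', φ '' (ψ '' A) = A := fun A hA => hφψ.image_image' hA
  refine le_iInf₂ fun ρ' hρ' => ?_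
  obtain ⟨Γ₀', -, hΓ₀', hadm⟩ := hρ'
  refine (iInf₂_le (fun C => ρ' (φ '' C)) ⟨{γ ∈ Γ | ∃ γ' ∈ Γ₀', γ'.I = γ.I ∧
    ∀ t ∈ γ.I, γ'.toFun t = φ (γ.toFun t)}, sep_subset _ _,
    hnull _ Γ₀' (fun γ hγ => hΓ γ hγ.1) hΓ₀' fun γ hγ => hγ.2, ?_⟩).trans ?_
  · let ι : {C : Set ↥Sphere2 // IsPeripheralCircle S C} →
        {C : Set ↥Sphere2 // IsPeripheralCircle (φ '' S) C} := fun C =>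
      ⟨φ '' C, C.2.image hφ hψ hmaps hψφ hSD⟩
    have hinj : Function.Injective ι := fun C₁ C₂ h => by
      rw [Subtype.ext_iff, ← hback C₁ (C₁.2.1.trans hSD), ← hback C₂ (C₂.2.1.trans hSD)]
      exact congrArg (ψ '' ·) (congrArg Subtype.val h)
    exact ENNReal.tsum_comp_le_tsum_of_injective hinj fun C => ρ' C ^ 2
  · rintro γ ⟨hγ, hγ₀⟩
    obtain ⟨γ', hγ', hI, hval⟩ := hrel γ hγ
    have himage : γ'.image = φ '' γ.image := by
      rw [SpherePath.image, SpherePath.image, hI, image_image]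
      exact image_congr hval
    refine (hadm γ' ⟨hγ', fun h => hγ₀ ⟨hγ, γ', h, hI, hval⟩⟩).trans ?_
    let ι : {C : Set ↥Sphere2 // IsPeripheralCircle (φ '' S) C ∧ (γ'.image ∩ C).Nonempty} →
        {C : Set ↥Sphere2 // IsPeripheralCircle S C ∧ (γ.image ∩ C).Nonempty} := fun C =>
      ⟨ψ '' C, by
        refine ⟨?_, ?_⟩
        · have h := C.2.1.image hψ hφ hmaps' hφψ hS'
          rwa [hback S hSD] at h
        · obtain ⟨y, hy, hyC⟩ := C.2.2
          refine ⟨ψ y, ?_, mem_image_of_mem ψ hyC⟩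
          rw [← hback _ (hΓ γ hγ), ← himage]
          exact mem_image_of_mem ψ hy⟩
    have hι : ∀ C, φ '' (ι C : Set ↥Sphere2) = C := fun C =>
      hforth _ (C.2.1.1.trans hS')
    have hinj : Function.Injective ι := fun C₁ C₂ h => by
      rw [Subtype.ext_iff, ← hι C₁, ← hι C₂, h]
    calc pathMassSum (φ '' S) ρ' γ' = ∑' C, ρ' (φ '' (ι C : Set ↥Sphere2)) := by
          simp only [hι]; rfl
      _ ≤ _ := ENNReal.tsum_comp_le_tsum_of_injective hinj _

end CarpetCombinatorics

/-- **Quasiconformal invariance of carpet modulus** (Lemma 2.1).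
Let `D` be a region in `S²`, `S ⊆ D` a carpet, and `Γ` a family of paths contained in
`D`.  If `f : D → D̃` is a quasiconformal homeomorphism onto a region `D̃ ⊆ S²`,
`S̃ := f(S)`, and `Γ̃ := {f ∘ γ : γ ∈ Γ}` (the family of paths agreeing with `f ∘ γ`,
`γ ∈ Γ`, on their parameter intervals), then `mod_{S̃}(Γ̃) = mod_S(Γ)`. -/
theorem carpetModulus_invariant_under_quasiconformal (D D' : Set ↥Sphere2)
    (S : Set ↥Sphere2) (hS : IsCarpet S) (hSD : S ⊆ D)
    (Γ : Set SpherePath) (hΓD : ∀ γ ∈ Γ, γ.image ⊆ D)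
    (f : ↥Sphere2 → ↥Sphere2) (hf : IsQuasiconformalOn f D D')
    (Γ' : Set SpherePath)
    (hΓ' : Γ' = {γ' : SpherePath | ∃ γ ∈ Γ, γ'.I = γ.I ∧
        ∀ t ∈ γ.I, γ'.toFun t = f (γ.toFun t)}) :
    carpetModulus (f '' S) Γ' = carpetModulus S Γ := by
  obtain ⟨hD, hD', hbij, hfc, ⟨g, hgc, hgf⟩, H, hH, hlim⟩ := hf
  have hmaps : MapsTo f D D' := hbij.mapsTo
  have hmaps' : MapsTo g D' D := fun y hy => by
    obtain ⟨x, hx, rfl⟩ := hbij.surjOn hy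
    rwa [hgf x hx]
  have hfg : LeftInvOn f g D' := fun y hy => by
    obtain ⟨x, hx, rfl⟩ := hbij.surjOn hy
    rw [hgf x hx]
  have hgf' : LeftInvOn g f D := fun x hx => hgf x hx
  have hdist := hasBoundedDistortionOn_of_limsup_le hH hlim
  have hK : 1 ≤ H.toReal + 1 := le_add_of_nonneg_left ENNReal.toReal_nonneg
  obtain ⟨c, C, hc, hct, -, hreg⟩ := sphereMeasure_regular
  have hlow := fun y r hr hr' => (hreg y r hr hr').1
  have hmem : ∀ {γ : SpherePath}, γ ∈ Γ → ∀ t ∈ γ.I, γ.toFun t ∈ D := fun {γ} hγ t ht =>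
    hΓD γ hγ (mem_image_of_mem _ ht)
  have hΓ'D : ∀ γ' ∈ Γ', γ'.image ⊆ D' := by
    rw [hΓ']
    rintro γ' ⟨γ, hγ, hI, hval⟩ _ ⟨t, ht, rfl⟩
    rw [hI] at ht
    rw [hval t ht]
    exact hmaps (hmem hγ t ht)
  refine le_antisymm ?_ ?_
  · have hle := carpetModulus_le_of_null_transfer hgc hfc hmaps' hfg hmaps hgf'
      ((image_mono hSD).trans hmaps.image_subset) (Γ' := Γ) hΓ'D (fun γ' hγ' => ?_)
      fun Γ₀ Γ₀' => conformalModulus_eq_zero_of_edist_sq_le hD' hgc hD hfc hgf'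
        (ENNReal.inv_ne_top.2 hc)
        (hdist.edist_inverse_sq_le hK hD hD' hfc hgc hmaps' hfg hc hct hlow)
    · rwa [hgf'.image_image' hSD] at hle
    · rw [hΓ'] at hγ'
      obtain ⟨γ, hγ, hI, hval⟩ := hγ'
      refine ⟨γ, hγ, hI.symm, fun t ht => ?_⟩
      rw [hI] at ht
      rw [hval t ht, hgf _ (hmem hγ t ht)]
  · refine carpetModulus_le_of_null_transfer hfc hgc hmaps hgf' hmaps' hfg hSD hΓD
      (fun γ hγ => ?_) fun Γ₀ Γ₀' => conformalModulus_eq_zero_of_edist_sq_le hD hfc hD' hgc hfg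
        (by finiteness)
        (hdist.edist_sq_le hK hD hD' hfc hgc hmaps hmaps' hfg hc hct hlow)
    refine ⟨⟨γ.I, γ.hI, fun t => f (γ.toFun t), hfc.comp γ.cont (hmem hγ)⟩, ?_, rfl,
      fun t _ => rfl⟩
    rw [hΓ']
    exact ⟨γ, hγ, rfl, fun t _ => rfl⟩
end

section
/- Let λ ≥ 1, let I be a countable index set, let (B_i)_{i∈I} be a collection of metric balls in S², and let (a_i)_{i∈I} be non-negative real numbers. Then there exists a constant C ≥ 0 depending only on λ such that ‖ Σ_{i∈I} a_i·χ_{λB_i} ‖_{L²(σ)} ≤ C · ‖ Σ_{i∈I} a_i·χ_{B_i} ‖_{L²(σ)}. -/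
open Set Metric

open MeasureTheory Filter Topology
open scoped ENNReal

theorem ENNReal.le_sq_mul_of_le_mul_rpow_half {M X K : ℝ≥0∞} (hM : M ≠ ⊤)
    (h : M ≤ K * (M ^ (1 / 2 : ℝ) * X ^ (1 / 2 : ℝ))) : M ≤ K ^ 2 * X := by
  rcases eq_or_ne M 0 with rfl | h0
  · simp
  have sq : ∀ Z : ℝ≥0∞, (Z ^ (1 / 2 : ℝ)) ^ 2 = Z := fun Z => by
    rw [← ENNReal.rpow_natCast, ← ENNReal.rpow_mul]; norm_num
  have h2 : M * M ≤ M * (K ^ 2 * X) := by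
    calc M * M = M ^ 2 := by ring
      _ ≤ (K * (M ^ (1 / 2 : ℝ) * X ^ (1 / 2 : ℝ))) ^ 2 := by gcongr
      _ = K ^ 2 * ((M ^ (1 / 2 : ℝ)) ^ 2 * (X ^ (1 / 2 : ℝ)) ^ 2) := by ring
      _ = _ := by rw [sq, sq]; ring
  exact (ENNReal.mul_le_mul_iff_right h0 hM).1 h2

section DoublingMeasure

variable {X ι : Type*} [MeasurableSpace X]

theorem lintegral_sum_indicator_mul_sum_indicator (μ : Measure X) (s : Finset ι)
    (c d : ι → ℝ≥0∞) (A B : ι → Set X) (hA : ∀ i, MeasurableSet (A i))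
    (hB : ∀ i, MeasurableSet (B i)) :
    ∫⁻ y, (∑ i ∈ s, (A i).indicator (fun _ => c i) y) *
        (∑ j ∈ s, (B j).indicator (fun _ => d j) y) ∂μ =
      ∑ i ∈ s, ∑ j ∈ s, c i * d j * μ (A i ∩ B j) := by
  have h : ∀ y, (∑ i ∈ s, (A i).indicator (fun _ => c i) y) *
        (∑ j ∈ s, (B j).indicator (fun _ => d j) y) =
      ∑ i ∈ s, ∑ j ∈ s, (A i ∩ B j).indicator (fun _ => c i * d j) y := by
    intro y
    rw [Finset.sum_mul_sum]
    refine Finset.sum_congr rfl fun i _ => Finset.sum_congr rfl fun j _ => ?_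
    exact (Set.inter_indicator_mul (fun _ => c i) (fun _ => d j) y).symm
  simp_rw [h]
  have hm : ∀ i j, Measurable ((A i ∩ B j).indicator (fun _ : X => c i * d j)) :=
    fun i j => measurable_const.indicator ((hA i).inter (hB j))
  rw [lintegral_finsetSum _ fun i _ => Finset.measurable_sum _ fun j _ => hm i j]
  refine Finset.sum_congr rfl fun i _ => ?_
  rw [lintegral_finsetSum _ fun j _ => hm i j]
  exact Finset.sum_congr rfl fun j _ => lintegral_indicator_const ((hA i).inter (hB j)) _

variable [PseudoMetricSpace X]

theorem measurable_sum_indicator_ball [OpensMeasurableSpace X]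
    (s : Finset ι) (x : ι → X) (r : ι → ℝ)
    (c : ι → ℝ≥0∞) :
    Measurable fun y => ∑ i ∈ s, (ball (x i) (r i)).indicator (fun _ => c i) y :=
  Finset.measurable_fun_sum _ fun _ _ => measurable_const.indicator measurableSet_ball

/-- The proportion of the ball `B(x, R r)` occupied by `B(x, r)`. -/
noncomputable def ballRatio (μ : Measure X) (x : X) (r R : ℝ) : ℝ≥0∞ :=
  μ (ball x r) / μ (ball x (R * r))

/-- The sum `∑ a_i (μ(B_i) / μ(R B_i)) χ_{R B_i}`, which spreads the mass of each `a_i χ_{B_i}`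
uniformly over the enlarged ball `R B_i`. -/
noncomputable def spreadSum (μ : Measure X) (s : Finset ι) (x : ι → X) (r : ι → ℝ)
    (a : ι → ℝ≥0∞) (R : ℝ) (y : X) : ℝ≥0∞ :=
  ∑ i ∈ s, (ball (x i) (R * r i)).indicator (fun _ => a i * ballRatio μ (x i) (r i) R) y

theorem measurable_spreadSum [OpensMeasurableSpace X] (μ : Measure X) (s : Finset ι) (x : ι → X)
    (r : ι → ℝ) (a : ι → ℝ≥0∞) (R : ℝ) : Measurable (spreadSum μ s x r a R) :=
  measurable_sum_indicator_ball s x _ _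

variable {μ : Measure X} {D : ℝ≥0∞}

theorem spreadSum_le_sum (s : Finset ι) (x : ι → X) (r : ι → ℝ) (a : ι → ℝ≥0∞)
    (hr : ∀ i, 0 < r i) {R : ℝ} (hR : 1 ≤ R) (y : X) :
    spreadSum μ s x r a R y ≤ ∑ i ∈ s, a i := by
  refine Finset.sum_le_sum fun i _ => (indicator_le_self _ _ _).trans ?_
  refine mul_le_of_le_one_right' ?_
  refine ENNReal.div_le_of_le_mul ?_
  rw [one_mul]
  exact measure_mono (ball_subset_ball (le_mul_of_one_le_left (hr i).le hR))

variable [IsFiniteMeasure μ]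

theorem ballRatio_le_mul_ballRatio_three (hpos : ∀ x r, 0 < r → μ (ball x r) ≠ 0)
    (hdoub : ∀ x r, 0 < r → μ (ball x (3 * r)) ≤ D * μ (ball x r))
    (x : X) {r R : ℝ} (hr : 0 < r) (hR : 0 < R) :
    ballRatio μ x r R ≤ D * ballRatio μ x r (3 * R) := by
  have hRr : 0 < R * r := mul_pos hR hr
  have h3 : 0 < 3 * R * r := by positivity
  rw [ballRatio, ballRatio, ENNReal.div_le_iff (hpos _ _ hRr) (measure_ne_top _ _)]
  have h := hdoub x (R * r) hRr
  rw [← mul_assoc] at h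
  calc μ (ball x r)
      = μ (ball x r) / μ (ball x (3 * R * r)) * μ (ball x (3 * R * r)) :=
        (ENNReal.div_mul_cancel (hpos _ _ h3) (measure_ne_top _ _)).symm
    _ ≤ μ (ball x r) / μ (ball x (3 * R * r)) * (D * μ (ball x (R * r))) := by gcongr
    _ = _ := by ring

theorem one_le_pow_mul_ballRatio (hpos : ∀ x r, 0 < r → μ (ball x r) ≠ 0)
    (hdoub : ∀ x r, 0 < r → μ (ball x (3 * r)) ≤ D * μ (ball x r))
    (x : X) {r : ℝ} (hr : 0 < r) (n : ℕ) : 1 ≤ D ^ n * ballRatio μ x r (3 ^ n) := by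
  induction n with
  | zero => simp [ballRatio, ENNReal.div_self (hpos x r hr) (measure_ne_top _ _)]
  | succ n ih =>
    refine ih.trans ?_
    rw [pow_succ D, pow_succ' (3 : ℝ), mul_assoc]
    gcongr
    exact ballRatio_le_mul_ballRatio_three hpos hdoub x hr (by positivity)

theorem ballRatio_mul_ballRatio_mul_measure_inter_le (hpos : ∀ x r, 0 < r → μ (ball x r) ≠ 0)
    (hdoub : ∀ x r, 0 < r → μ (ball x (3 * r)) ≤ D * μ (ball x r))
    (x x' : X) {r r' R : ℝ} (hr : 0 < r) (hr' : 0 < r') (hrr : r' ≤ r) (hR : 1 ≤ R) :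
    ballRatio μ x r R * ballRatio μ x' r' R * μ (ball x (R * r) ∩ ball x' (R * r')) ≤
      D * (ballRatio μ x r (3 * R) * μ (ball x (3 * R * r) ∩ ball x' r')) := by
  have hR0 : 0 < R := by linarith
  rcases (ball x (R * r) ∩ ball x' (R * r')).eq_empty_or_nonempty with h | ⟨z, hz, hz'⟩
  · simp [h]
  have hsub : ball x' r' ⊆ ball x (3 * R * r) := by
    apply ball_subset_ball'
    have h1 := dist_triangle_right x' x z
    rw [mem_ball, dist_comm] at hz hz'
    have : dist x' x < R * r' + R * r := by linarith
    nlinarith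
  rw [inter_eq_self_of_subset_right hsub]
  calc ballRatio μ x r R * ballRatio μ x' r' R * μ (ball x (R * r) ∩ ball x' (R * r'))
      ≤ ballRatio μ x r R * ballRatio μ x' r' R * μ (ball x' (R * r')) := by
        gcongr; exact inter_subset_right
    _ = ballRatio μ x r R * μ (ball x' r') := by
        rw [mul_assoc]
        congr 1
        exact ENNReal.div_mul_cancel (hpos _ _ (mul_pos hR0 hr')) (measure_ne_top _ _)
    _ ≤ D * ballRatio μ x r (3 * R) * μ (ball x' r') := by
        gcongr; exact ballRatio_le_mul_ballRatio_three hpos hdoub x hr hR0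
    _ = _ := by ring

variable [OpensMeasurableSpace X]

theorem lintegral_spreadSum_sq_le (hpos : ∀ x r, 0 < r → μ (ball x r) ≠ 0)
    (hdoub : ∀ x r, 0 < r → μ (ball x (3 * r)) ≤ D * μ (ball x r))
    (s : Finset ι) (x : ι → X) (r : ι → ℝ) (a : ι → ℝ≥0∞) (hr : ∀ i, 0 < r i)
    {R : ℝ} (hR : 1 ≤ R) :
    ∫⁻ y, spreadSum μ s x r a R y ^ 2 ∂μ ≤
      2 * D * ∫⁻ y, spreadSum μ s x r a (3 * R) y *
        (∑ j ∈ s, (ball (x j) (r j)).indicator (fun _ => a j) y) ∂μ := by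
  simp_rw [sq, spreadSum]
  rw [lintegral_sum_indicator_mul_sum_indicator μ s _ _ _ _ (fun _ => measurableSet_ball)
      (fun _ => measurableSet_ball),
    lintegral_sum_indicator_mul_sum_indicator μ s _ _ _ _ (fun _ => measurableSet_ball)
      (fun _ => measurableSet_ball)]
  set T : ι → ι → ℝ≥0∞ := fun i j => a i * ballRatio μ (x i) (r i) (3 * R) * a j *
    μ (ball (x i) (3 * R * r i) ∩ ball (x j) (r j)) with hT
  have key : ∀ i j, r j ≤ r i → a i * ballRatio μ (x i) (r i) R *
      (a j * ballRatio μ (x j) (r j) R) * μ (ball (x i) (R * r i) ∩ ball (x j) (R * r j)) ≤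
      D * T i j := by
    intro i j hij
    have h := ballRatio_mul_ballRatio_mul_measure_inter_le hpos hdoub (x i) (x j) (hr i) (hr j)
      hij hR
    calc _ = a i * a j * (ballRatio μ (x i) (r i) R * ballRatio μ (x j) (r j) R *
          μ (ball (x i) (R * r i) ∩ ball (x j) (R * r j))) := by ring
      _ ≤ a i * a j * (D * (ballRatio μ (x i) (r i) (3 * R) *
          μ (ball (x i) (3 * R * r i) ∩ ball (x j) (r j)))) := by gcongr
      _ = _ := by rw [hT]; ring
  calc _ ≤ ∑ i ∈ s, ∑ j ∈ s, (D * T i j + D * T j i) := by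
        refine Finset.sum_le_sum fun i _ => Finset.sum_le_sum fun j _ => ?_
        rcases le_total (r j) (r i) with hij | hij
        · exact (key i j hij).trans le_self_add
        · have h := key j i hij
          rw [inter_comm, mul_comm (a j * _)] at h
          exact h.trans le_add_self
    _ = 2 * D * ∑ i ∈ s, ∑ j ∈ s, T i j := by
        simp_rw [Finset.sum_add_distrib, ← Finset.mul_sum]
        rw [Finset.sum_comm (f := fun i j => T j i)]
        ring

theorem lintegral_spreadSum_sq_le_lintegral_sq (hpos : ∀ x r, 0 < r → μ (ball x r) ≠ 0)
    (hdoub : ∀ x r, 0 < r → μ (ball x (3 * r)) ≤ D * μ (ball x r))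
    (s : Finset ι) (x : ι → X) (r : ι → ℝ) (a : ι → ℝ≥0∞) (hr : ∀ i, 0 < r i)
    (ha : ∀ i, a i ≠ ⊤) (n : ℕ) :
    ∫⁻ y, spreadSum μ s x r a (3 ^ n) y ^ 2 ∂μ ≤
      (2 * D) ^ 2 * ∫⁻ y, (∑ j ∈ s, (ball (x j) (r j)).indicator (fun _ => a j) y) ^ 2 ∂μ := by
  have h1 : ∀ m : ℕ, (1 : ℝ) ≤ 3 ^ m := fun m => one_le_pow₀ (by norm_num)
  set M : ℝ≥0∞ := ⨆ m : ℕ, ∫⁻ y, spreadSum μ s x r a (3 ^ m) y ^ 2 ∂μ with hM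
  have hMtop : M ≠ ⊤ := by
    refine ne_top_of_le_ne_top (b := (∑ i ∈ s, a i) ^ 2 * μ univ) ?_ (iSup_le fun m => ?_)
    · exact ENNReal.mul_ne_top (ENNReal.pow_ne_top (ENNReal.sum_ne_top.2 fun i _ => ha i))
        (measure_ne_top _ _)
    · rw [← lintegral_const]
      exact lintegral_mono fun y => by gcongr; exact spreadSum_le_sum s x r a hr (h1 m) y
  refine (le_iSup (fun m : ℕ => ∫⁻ y, spreadSum μ s x r a (3 ^ m) y ^ 2 ∂μ) n).trans ?_
  refine ENNReal.le_sq_mul_of_le_mul_rpow_half hMtop (iSup_le fun m => ?_)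
  refine (lintegral_spreadSum_sq_le hpos hdoub s x r a hr (h1 m)).trans ?_
  rw [← pow_succ']
  gcongr
  have hh := ENNReal.lintegral_mul_le_Lp_mul_Lq μ Real.HolderConjugate.two_two
    (measurable_spreadSum μ s x r a (3 ^ (m + 1))).aemeasurable
    (measurable_sum_indicator_ball s x r a).aemeasurable
  simp only [Pi.mul_apply, ENNReal.rpow_two] at hh
  refine hh.trans ?_
  gcongr
  exact le_iSup (fun m : ℕ => ∫⁻ y, spreadSum μ s x r a (3 ^ m) y ^ 2 ∂μ) (m + 1)

theorem lintegral_sum_indicator_ball_mul_sq_le (hpos : ∀ x r, 0 < r → μ (ball x r) ≠ 0)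
    (hdoub : ∀ x r, 0 < r → μ (ball x (3 * r)) ≤ D * μ (ball x r))
    (s : Finset ι) (x : ι → X) (r : ι → ℝ) (a : ι → ℝ≥0∞) (hr : ∀ i, 0 < r i)
    (ha : ∀ i, a i ≠ ⊤) {n : ℕ} {lam : ℝ} (hlam : lam ≤ 3 ^ n) :
    ∫⁻ y, (∑ i ∈ s, (ball (x i) (lam * r i)).indicator (fun _ => a i) y) ^ 2 ∂μ ≤
      (D ^ n * (2 * D)) ^ 2 *
        ∫⁻ y, (∑ i ∈ s, (ball (x i) (r i)).indicator (fun _ => a i) y) ^ 2 ∂μ := by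
  have hpt : ∀ y, (∑ i ∈ s, (ball (x i) (lam * r i)).indicator (fun _ => a i) y) ^ 2 ≤
      (D ^ n) ^ 2 * spreadSum μ s x r a (3 ^ n) y ^ 2 := by
    intro y
    rw [← mul_pow]
    gcongr
    rw [spreadSum, Finset.mul_sum]
    refine Finset.sum_le_sum fun i _ => ?_
    refine (indicator_le_indicator_of_subset (ball_subset_ball
      (mul_le_mul_of_nonneg_right hlam (hr i).le)) (fun _ => zero_le) y).trans ?_
    by_cases hy : y ∈ ball (x i) (3 ^ n * r i)
    · rw [indicator_of_mem hy, indicator_of_mem hy, mul_left_comm]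
      exact le_mul_of_one_le_right' (one_le_pow_mul_ballRatio hpos hdoub (x i) (hr i) n)
    · simp [hy]
  refine (lintegral_mono hpt).trans ?_
  rw [lintegral_const_mul _ ((measurable_spreadSum μ s x r a _).pow_const 2), mul_pow,
    mul_assoc]
  gcongr
  exact lintegral_spreadSum_sq_le_lintegral_sq hpos hdoub s x r a hr ha n

theorem lintegral_tsum_indicator_ball_mul_sq_le [Countable ι]
    (hpos : ∀ x r, 0 < r → μ (ball x r) ≠ 0)
    (hdoub : ∀ x r, 0 < r → μ (ball x (3 * r)) ≤ D * μ (ball x r))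
    (x : ι → X) (r : ι → ℝ) (a : ι → ℝ≥0∞) (hr : ∀ i, 0 < r i)
    (ha : ∀ i, a i ≠ ⊤) {n : ℕ} {lam : ℝ} (hlam : lam ≤ 3 ^ n) :
    ∫⁻ y, (∑' i, (ball (x i) (lam * r i)).indicator (fun _ => a i) y) ^ 2 ∂μ ≤
      (D ^ n * (2 * D)) ^ 2 *
        ∫⁻ y, (∑' i, (ball (x i) (r i)).indicator (fun _ => a i) y) ^ 2 ∂μ := by
  have hmono : Monotone fun (s : Finset ι) (y : X) =>
      (∑ i ∈ s, (ball (x i) (lam * r i)).indicator (fun _ => a i) y) ^ 2 := fun s t hst y => by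
    dsimp only
    gcongr
  have hsup : ∀ y, (∑' i, (ball (x i) (lam * r i)).indicator (fun _ => a i) y) ^ 2 =
      ⨆ s : Finset ι, (∑ i ∈ s, (ball (x i) (lam * r i)).indicator (fun _ => a i) y) ^ 2 := by
    intro y
    rw [ENNReal.tsum_eq_iSup_sum, ENNReal.iSup_pow]
  simp_rw [hsup]
  rw [lintegral_iSup_directed
    (fun s => ((measurable_sum_indicator_ball s x _ _).pow_const 2).aemeasurable)
    hmono.directed_le]
  refine iSup_le fun s => ?_
  refine (lintegral_sum_indicator_ball_mul_sq_le hpos hdoub s x r a hr ha hlam).trans ?_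
  gcongr
  exact ENNReal.sum_le_tsum s

end DoublingMeasure

theorem exists_orthonormalBasis_eq_sphere2 (x : ↥Sphere2) :
    ∃ b : OrthonormalBasis (Fin 3) ℝ (EuclideanSpace ℝ (Fin 3)), b 0 = x := by
  have hx : ‖(x : EuclideanSpace ℝ (Fin 3))‖ = 1 := mem_sphere_zero_iff_norm.1 x.2
  have ho : Orthonormal ℝ (({0} : Set (Fin 3)).domRestrict
      fun _ => (x : EuclideanSpace ℝ (Fin 3))) :=
    ⟨fun _ => hx, fun i j hij => (hij (Subsingleton.elim i j)).elim⟩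
  obtain ⟨b, hb⟩ := ho.exists_orthonormalBasis_extension_of_card_eq (by simp)
  exact ⟨b, hb 0 rfl⟩

/-- The coordinates, in an orthonormal basis `b`, of the projection of a point of the sphere to
the plane orthogonal to `b 0`. -/
noncomputable def tangentCoord (b : OrthonormalBasis (Fin 3) ℝ (EuclideanSpace ℝ (Fin 3)))
    (y : ↥Sphere2) : Fin 2 → ℝ :=
  fun i => b.repr y i.succ

theorem dist_sq_eq_sum_repr (b : OrthonormalBasis (Fin 3) ℝ (EuclideanSpace ℝ (Fin 3)))
    (y z : EuclideanSpace ℝ (Fin 3)) :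
    dist y z ^ 2 = (b.repr y 0 - b.repr z 0) ^ 2 + (b.repr y 1 - b.repr z 1) ^ 2 +
      (b.repr y 2 - b.repr z 2) ^ 2 := by
  rw [← b.repr.dist_map, EuclideanSpace.dist_eq, Real.sq_sqrt (by positivity)]
  simp [Fin.sum_univ_three, Real.dist_eq, sq_abs]

theorem sum_repr_sq_eq_one (b : OrthonormalBasis (Fin 3) ℝ (EuclideanSpace ℝ (Fin 3)))
    (y : ↥Sphere2) : b.repr y 0 ^ 2 + b.repr y 1 ^ 2 + b.repr y 2 ^ 2 = 1 := by
  have h := dist_sq_eq_sum_repr b y 0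
  have hy : dist (y : EuclideanSpace ℝ (Fin 3)) 0 = 1 := y.2
  simpa [hy] using h.symm

theorem lipschitzWith_tangentCoord
    (b : OrthonormalBasis (Fin 3) ℝ (EuclideanSpace ℝ (Fin 3))) :
    LipschitzWith 1 (tangentCoord b) := by
  refine LipschitzWith.of_dist_le_mul fun y z => ?_
  rw [NNReal.coe_one, one_mul, dist_pi_le_iff dist_nonneg]
  intro i
  rw [Real.dist_eq, Subtype.dist_eq]
  apply abs_le_of_sq_le_sq _ dist_nonneg
  rw [dist_sq_eq_sum_repr b]
  fin_cases i <;> simp [tangentCoord] <;> nlinarith [sq_nonneg (b.repr y 0 - b.repr z 0),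
    sq_nonneg (b.repr y 1 - b.repr z 1), sq_nonneg (b.repr y 2 - b.repr z 2)]

theorem repr_zero_of_dist (b : OrthonormalBasis (Fin 3) ℝ (EuclideanSpace ℝ (Fin 3)))
    (y : ↥Sphere2) : dist (y : EuclideanSpace ℝ (Fin 3)) (b 0) ^ 2 = 2 - 2 * b.repr y 0 := by
  have h := dist_sq_eq_sum_repr b y (b 0)
  have hy := sum_repr_sq_eq_one b y
  simp [b.repr_self] at h
  rw [h]
  linarith

theorem sub_sq_le_four_mul_of_sq_add_sq_add_sq_eq_one {t u v t' u' v' : ℝ}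
    (h : t ^ 2 + u ^ 2 + v ^ 2 = 1) (h' : t' ^ 2 + u' ^ 2 + v' ^ 2 = 1)
    (ht : 1 / 2 < t) (ht' : 1 / 2 < t') :
    (t - t') ^ 2 ≤ 4 * ((u - u') ^ 2 + (v - v') ^ 2) := by
  have e : (t - t') * (t + t') = (u' - u) * (u + u') + (v' - v) * (v + v') := by linarith
  have e4 : (u + u') ^ 2 + (v + v') ^ 2 ≤ 4 := by
    linarith [sq_nonneg (u - u'), sq_nonneg (v - v'), sq_nonneg t, sq_nonneg t']
  calc (t - t') ^ 2 ≤ (t - t') ^ 2 * (t + t') ^ 2 :=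
        le_mul_of_one_le_right (sq_nonneg _) (one_le_pow₀ (by linarith))
    _ = ((u' - u) * (u + u') + (v' - v) * (v + v')) ^ 2 := by rw [← mul_pow, e]
    _ ≤ ((u + u') ^ 2 + (v + v') ^ 2) * ((u - u') ^ 2 + (v - v') ^ 2) := by
        linarith [sq_nonneg ((u' - u) * (v + v') - (v' - v) * (u + u'))]
    _ ≤ 4 * ((u - u') ^ 2 + (v - v') ^ 2) := by gcongr

theorem dist_le_four_mul_dist_tangentCoord
    (b : OrthonormalBasis (Fin 3) ℝ (EuclideanSpace ℝ (Fin 3))) {y z : ↥Sphere2}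
    (hy : dist (y : EuclideanSpace ℝ (Fin 3)) (b 0) < 1)
    (hz : dist (z : EuclideanSpace ℝ (Fin 3)) (b 0) < 1) :
    dist y z ≤ 4 * dist (tangentCoord b y) (tangentCoord b z) := by
  have hy0 := repr_zero_of_dist b y
  have hz0 := repr_zero_of_dist b z
  have hy1 := sum_repr_sq_eq_one b y
  have hz1 := sum_repr_sq_eq_one b z
  have hd := dist_sq_eq_sum_repr b y z
  have h1 : (b.repr y 1 - b.repr z 1) ^ 2 ≤ dist (tangentCoord b y) (tangentCoord b z) ^ 2 := by
    rw [← sq_abs]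
    gcongr
    exact dist_le_pi_dist (tangentCoord b y) (tangentCoord b z) 0
  have h2 : (b.repr y 2 - b.repr z 2) ^ 2 ≤ dist (tangentCoord b y) (tangentCoord b z) ^ 2 := by
    rw [← sq_abs]
    gcongr
    exact dist_le_pi_dist (tangentCoord b y) (tangentCoord b z) 1
  have hy2 : 1 / 2 < b.repr y 0 := by
    nlinarith [dist_nonneg (x := (y : EuclideanSpace ℝ (Fin 3))) (y := b 0)]
  have hz2 : 1 / 2 < b.repr z 0 := by
    nlinarith [dist_nonneg (x := (z : EuclideanSpace ℝ (Fin 3))) (y := b 0)]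
  have h0 := sub_sq_le_four_mul_of_sq_add_sq_add_sq_eq_one hy1 hz1 hy2 hz2
  rw [Subtype.dist_eq, ← sq_le_sq₀ dist_nonneg (by positivity), hd]
  linarith [sq_nonneg (dist (tangentCoord b y) (tangentCoord b z))]

theorem sphereMeasure_ball_le (x : ↥Sphere2) {r : ℝ} (hr : 0 < r) (hr1 : r ≤ 1) :
    sphereMeasure (ball x r) ≤ ENNReal.ofReal (64 * r ^ 2) := by
  obtain ⟨b, hb⟩ := exists_orthonormalBasis_eq_sphere2 x
  set f : ball x r → (Fin 2 → ℝ) := fun y => tangentCoord b y with hf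
  have hanti : AntilipschitzWith 4 f := AntilipschitzWith.of_le_mul_dist fun y z => by
    refine dist_le_four_mul_dist_tangentCoord b ?_ ?_
    · rw [hb]; exact (mem_ball.1 y.2).trans_le hr1
    · rw [hb]; exact (mem_ball.1 z.2).trans_le hr1
  have himg : f '' univ ⊆ ball (tangentCoord b x) r := by
    rintro _ ⟨y, -, rfl⟩
    refine mem_ball.2 (lt_of_le_of_lt ?_ (mem_ball.1 y.2))
    simpa using (lipschitzWith_tangentCoord b).dist_le_mul y x
  have hcoe := (isometry_subtype_coe (s := ball x r)).hausdorffMeasure_image (d := 2)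
    (Or.inl zero_le_two) univ
  rw [image_univ, Subtype.range_coe] at hcoe
  rw [sphereMeasure, hcoe]
  refine (hanti.le_hausdorffMeasure_image zero_le_two univ).trans ?_
  have hvol : (μH[2] : Measure (Fin 2 → ℝ)) = volume := by
    simpa using hausdorffMeasure_pi_real (ι := Fin 2)
  rw [hvol]
  refine (mul_le_mul_right (measure_mono himg) _).trans ?_
  rw [Real.volume_pi_ball _ hr]
  have h4 : ((4 : NNReal) : ℝ≥0∞) ^ (2 : ℝ) = ENNReal.ofReal 16 := by
    rw [ENNReal.rpow_two]; norm_num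
  rw [h4, ← ENNReal.ofReal_mul (by norm_num)]
  apply ENNReal.ofReal_le_ofReal
  simp only [Fintype.card_fin]
  nlinarith

theorem ball_subset_image_tangentCoord
    (b : OrthonormalBasis (Fin 3) ℝ (EuclideanSpace ℝ (Fin 3))) {x : ↥Sphere2} (hb : b 0 = x)
    {r : ℝ} (hr : 0 < r) (hr1 : r ≤ 1) :
    ball (0 : Fin 2 → ℝ) (r / 2) ⊆ tangentCoord b '' ball x r := by
  intro v hv
  rw [mem_ball_zero_iff, pi_norm_lt_iff (by positivity)] at hv
  have h0 : v 0 ^ 2 < (r / 2) ^ 2 := sq_lt_sq' (abs_lt.1 (hv 0)).1 (abs_lt.1 (hv 0)).2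
  have h1 : v 1 ^ 2 < (r / 2) ^ 2 := sq_lt_sq' (abs_lt.1 (hv 1)).1 (abs_lt.1 (hv 1)).2
  set t := Real.sqrt (1 - v 0 ^ 2 - v 1 ^ 2) with ht
  have htsq : t ^ 2 = 1 - v 0 ^ 2 - v 1 ^ 2 := Real.sq_sqrt (by nlinarith)
  have ht0 : 0 ≤ t := Real.sqrt_nonneg _
  set y : EuclideanSpace ℝ (Fin 3) := b.repr.symm !₂[t, v 0, v 1] with hy
  have hyS : y ∈ Sphere2 := by
    have h : dist y 0 ^ 2 = 1 := by
      rw [dist_sq_eq_sum_repr b]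
      simp [hy]
      linarith
    exact mem_sphere.2 ((pow_eq_one_iff_of_nonneg dist_nonneg two_ne_zero).1 h)
  refine ⟨⟨y, hyS⟩, ?_, ?_⟩
  · have h := repr_zero_of_dist b ⟨y, hyS⟩
    rw [hb] at h
    rw [mem_ball, Subtype.dist_eq]
    rw [← sq_lt_sq₀ dist_nonneg hr.le, h]
    simp [hy]
    nlinarith
  · ext i
    fin_cases i <;> simp [tangentCoord, hy]

theorem le_sphereMeasure_ball (x : ↥Sphere2) {r : ℝ} (hr : 0 < r) (hr1 : r ≤ 1) :
    ENNReal.ofReal (r ^ 2) ≤ sphereMeasure (ball x r) := by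
  obtain ⟨b, hb⟩ := exists_orthonormalBasis_eq_sphere2 x
  have hvol : (μH[2] : Measure (Fin 2 → ℝ)) = volume := by
    simpa using hausdorffMeasure_pi_real (ι := Fin 2)
  have h := (lipschitzWith_tangentCoord b).hausdorffMeasure_image_le (d := 2) zero_le_two (ball x r)
  rw [hvol, ENNReal.coe_one, ENNReal.one_rpow, one_mul] at h
  refine le_trans ?_ ((measure_mono (ball_subset_image_tangentCoord b hb hr hr1)).trans h)
  rw [Real.volume_pi_ball _ (by positivity)]
  simp [mul_div_cancel₀]

instance : IsFiniteMeasure sphereMeasure := by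
  have : CompactSpace ↥Sphere2 := isCompact_iff_compactSpace.1 (isCompact_sphere 0 1)
  have : IsLocallyFiniteMeasure sphereMeasure := ⟨fun x => ⟨ball x 1, ball_mem_nhds x one_pos,
    (sphereMeasure_ball_le x one_pos le_rfl).trans_lt ENNReal.ofReal_lt_top⟩⟩
  infer_instance

theorem sphereMeasure_ball_ne_zero (x : ↥Sphere2) (r : ℝ) (hr : 0 < r) :
    sphereMeasure (ball x r) ≠ 0 := by
  have h := (le_sphereMeasure_ball x (lt_min hr one_pos) (min_le_right r 1)).trans
    (measure_mono (ball_subset_ball (min_le_left r 1)))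
  have : 0 < min r 1 := lt_min hr one_pos
  exact ((ENNReal.ofReal_pos.2 (by positivity)).trans_le h).ne'

theorem exists_sphereMeasure_ball_three_mul_le :
    ∃ D : ℝ≥0∞, D ≠ ⊤ ∧ ∀ (x : ↥Sphere2) (r : ℝ), 0 < r →
      sphereMeasure (ball x (3 * r)) ≤ D * sphereMeasure (ball x r) := by
  refine ⟨576 + 9 * sphereMeasure univ,
    by finiteness, fun x r hr => ?_⟩
  rcases le_total r (1 / 3) with h | h
  · calc sphereMeasure (ball x (3 * r)) ≤ ENNReal.ofReal (64 * (3 * r) ^ 2) :=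
        sphereMeasure_ball_le x (by positivity) (by linarith)
      _ = 576 * ENNReal.ofReal (r ^ 2) := by
        rw [← ENNReal.ofReal_ofNat, ← ENNReal.ofReal_mul (by norm_num)]; congr 1; ring
      _ ≤ _ := by
        gcongr
        · exact le_self_add
        · exact le_sphereMeasure_ball x hr (by linarith)
  · have h1 : ENNReal.ofReal ((1 / 3) ^ 2) ≤ sphereMeasure (ball x r) :=
      (le_sphereMeasure_ball x (by norm_num) (by norm_num)).trans
        (measure_mono (ball_subset_ball h))
    have h9 : (9 : ℝ≥0∞) * ENNReal.ofReal ((1 / 3) ^ 2) = 1 := by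
      rw [← ENNReal.ofReal_ofNat, ← ENNReal.ofReal_mul (by norm_num)]; norm_num
    calc sphereMeasure (ball x (3 * r)) ≤ sphereMeasure univ := measure_mono (subset_univ _)
      _ = 9 * sphereMeasure univ * ENNReal.ofReal ((1 / 3) ^ 2) := by
        rw [mul_right_comm, h9, one_mul]
      _ ≤ _ := by
        gcongr
        exact le_add_self

/-- **A maximal-function inequality for sums of characteristic functions of balls**
(Lemma 2.2).  Let `λ ≥ 1`.  There is a constant `C ≥ 0` depending only on `λ` such that
for every countable collection of spherical disks `B_i = B(x_i, r_i)` in `S²` and all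
non-negative coefficients `a_i`,
`‖Σ_i a_i χ_{λB_i}‖_{L²(σ)} ≤ C · ‖Σ_i a_i χ_{B_i}‖_{L²(σ)}`. -/
theorem enlarged_balls_L2_inequality (lam : ℝ) (hlam : 1 ≤ lam) :
    ∃ C : ℝ, 0 ≤ C ∧
      ∀ (I : Type) (_ : Countable I) (x : I → ↥Sphere2) (r : I → ℝ) (a : I → ℝ),
        (∀ i, 0 < r i) → (∀ i, 0 ≤ a i) →
        (∫⁻ y, (∑' i : I, Set.indicator (Metric.ball (x i) (lam * r i))
            (fun _ => ENNReal.ofReal (a i)) y) ^ 2 ∂sphereMeasure) ^ (1/2 : ℝ) ≤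
          ENNReal.ofReal C *
          (∫⁻ y, (∑' i : I, Set.indicator (Metric.ball (x i) (r i))
              (fun _ => ENNReal.ofReal (a i)) y) ^ 2 ∂sphereMeasure) ^ (1/2 : ℝ) := by
  obtain ⟨D, hD, hdoub⟩ := exists_sphereMeasure_ball_three_mul_le
  obtain ⟨n, hn⟩ := pow_unbounded_of_one_lt lam (by norm_num : (1 : ℝ) < 3)
  have hK : D ^ n * (2 * D) ≠ ⊤ := by finiteness
  refine ⟨(D ^ n * (2 * D)).toReal, ENNReal.toReal_nonneg, ?_⟩
  intro I _ x r a hr _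
  have h := lintegral_tsum_indicator_ball_mul_sq_le sphereMeasure_ball_ne_zero hdoub x r
    (fun i => ENNReal.ofReal (a i)) hr (fun _ => ENNReal.ofReal_ne_top) hn.le
  refine (ENNReal.rpow_le_rpow h (by norm_num : (0 : ℝ) ≤ 1 / 2)).trans_eq ?_
  rw [ENNReal.mul_rpow_of_nonneg _ _ (by norm_num), ← ENNReal.rpow_natCast, ← ENNReal.rpow_mul,
    ENNReal.ofReal_toReal hK]
  norm_num
end
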